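/- arXiv:1807.04684 — 2 statements merged into one kernel-verified Lean document; each statement's English description precedes it below -/
import Mathlib

section
/- Let 0 < p < 1, 1 < α < 2, and let μ, ν ∈ (α−2, 0) satisfy μ + ν = α − 2 and p·sin(πμ) = (1−p)·sin(πν); set C_{α,p} = (sin(πμ) + sin(πν))/sin(πα). Then for every t ∈ (0,1) and every integer k ≥ 0, C_{α,p}·( p·(₀I_t^{2−α} g)(t) + (1−p)·(ₜI_1^{2−α} g)(t) ) = Σ_{j=0}^{k} a_{k,j} t^j, where g(s) = s^{ν+k}(1−s)^μ and a_{k,j} = (−1)^{k+j} Γ(j+α−1) Γ(μ+1) / ( Γ(α−1−ν−k+j) Γ(j+1) Γ(k+1−j) ), with the convention that 1/Γ(m) = 0 when m is a non-positive integer. -/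
open MeasureTheory Real Set Finset

noncomputable section

/-- Left Riemann–Liouville fractional integral of order `σ` on `(0,1)`. -/
def I0l (σ : ℝ) (g : ℝ → ℝ) (t : ℝ) : ℝ :=
  (1 / Real.Gamma σ) * ∫ s in (0 : ℝ)..t, (t - s) ^ (σ - 1) * g s

/-- Right Riemann–Liouville fractional integral of order `σ` on `(0,1)`. -/
def I0r (σ : ℝ) (g : ℝ → ℝ) (t : ℝ) : ℝ :=
  (1 / Real.Gamma σ) * ∫ s in t..(1 : ℝ), (s - t) ^ (σ - 1) * g s

/-- The constant `C_{α,p} = (sin(πμ) + sin(πν)) / sin(πα)`. -/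
def Cap (α μ ν : ℝ) : ℝ := (Real.sin (π * μ) + Real.sin (π * ν)) / Real.sin (π * α)

/-- The coefficients `a_{k,j}`; note that in Lean division by zero is zero, which
implements the convention `1/Γ(m) = 0` for non-positive integers `m`
(since `Real.Gamma` vanishes at non-positive integers). -/
def acoef (α μ ν : ℝ) (k j : ℕ) : ℝ :=
  (-1 : ℝ) ^ (k + j) * (Real.Gamma (j + α - 1) * Real.Gamma (μ + 1)) /
    (Real.Gamma (α - 1 - ν - k + j) * Real.Gamma (j + 1) * Real.Gamma (k + 1 - j))

/-- The Euler-type integral `∫₀ᵗ (t - s)^(β - 1) s^a (1 - s)^b ds`. -/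
def eulerIntegral (β a b t : ℝ) : ℝ :=
  ∫ s in (0 : ℝ)..t, (t - s) ^ (β - 1) * (s ^ a * (1 - s) ^ b)

lemma intervalIntegrable_sub_rpow_mul_rpow {β a t : ℝ} (hβ : 0 < β) (ha : -1 < a) (ht : 0 < t) :
    IntervalIntegrable (fun s => (t - s) ^ (β - 1) * s ^ a) volume 0 t := by
  have half : ∀ c d : ℝ, -1 < c →
      IntervalIntegrable (fun s => (t - s) ^ d * s ^ c) volume 0 (t / 2) := by
    intro c d hc
    refine (intervalIntegral.intervalIntegrable_rpow' hc).continuousOn_mul ?_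
    refine ContinuousOn.rpow_const (by fun_prop) fun s hs => Or.inl ?_
    rw [Set.uIcc_of_le (by linarith)] at hs
    linarith [hs.2]
  refine (half a (β - 1) ha).trans ?_
  have h := (half (β - 1) a (by linarith)).comp_sub_left t
  simp only [sub_sub_cancel, sub_zero, sub_half] at h
  refine h.symm.congr ?_
  exact fun s _ => mul_comm _ _

lemma intervalIntegrable_euler_mul {β a b t : ℝ} (hβ : 0 < β) (ha : -1 < a) (ht0 : 0 < t)
    (ht1 : t < 1) {h : ℝ → ℝ} (hh : Continuous h) :
    IntervalIntegrable (fun s => (t - s) ^ (β - 1) * (s ^ a * (1 - s) ^ b) * h s) volume 0 t := by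
  have hc : ContinuousOn (fun s : ℝ => (1 - s) ^ b * h s) (Set.uIcc 0 t) := by
    refine ContinuousOn.mul (ContinuousOn.rpow_const (by fun_prop) fun s hs => Or.inl ?_)
      hh.continuousOn
    rw [Set.uIcc_of_le ht0.le] at hs
    linarith [hs.2]
  refine ((intervalIntegrable_sub_rpow_mul_rpow hβ ha ht0).mul_continuousOn hc).congr ?_
  intro s _
  ring

/-- Integrating the derivative of `(t - s)^β s^(a + 1) (1 - s)^(b + 1)`. -/
lemma integral_euler_mul_quadratic {β a b t : ℝ} (hβ : 0 < β) (ha : -1 < a)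
    (ht0 : 0 < t) (ht1 : t < 1) :
    ∫ s in (0 : ℝ)..t, (t - s) ^ (β - 1) * (s ^ a * (1 - s) ^ b) *
      ((a + 1) * (1 - s) * (t - s) - (b + 1) * s * (t - s) - β * s * (1 - s)) = 0 := by
  have hcont : ContinuousOn (fun s : ℝ => (t - s) ^ β * (s ^ (a + 1) * (1 - s) ^ (b + 1)))
      (Set.Icc 0 t) := by
    refine ContinuousOn.mul ?_ (ContinuousOn.mul ?_ ?_)
    · exact ContinuousOn.rpow_const (by fun_prop) fun s hs => Or.inr hβ.le
    · exact ContinuousOn.rpow_const (by fun_prop) fun s hs => Or.inr (by linarith)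
    · exact ContinuousOn.rpow_const (by fun_prop) fun s hs => Or.inl (by linarith [hs.2])
  rw [intervalIntegral.integral_eq_sub_of_hasDerivAt_of_le ht0.le hcont]
  · simp [Real.zero_rpow hβ.ne', Real.zero_rpow (show a + 1 ≠ 0 by linarith)]
  · intro s hs
    have h1 : 0 < t - s := by linarith [hs.2]
    have h2 : 0 < s := hs.1
    have h3 : 0 < 1 - s := by linarith [hs.2]
    have d1 := ((hasDerivAt_id s).const_sub t).rpow_const (p := β) (Or.inl h1.ne')
    have d2 := (hasDerivAt_id s).rpow_const (p := a + 1) (Or.inl h2.ne')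
    have d3 := ((hasDerivAt_id s).const_sub 1).rpow_const (p := b + 1) (Or.inl h3.ne')
    refine (d1.fun_mul (d2.fun_mul d3)).congr_deriv ?_
    have e1 : (t - s) ^ β = (t - s) ^ (β - 1) * (t - s) := by
      rw [← Real.rpow_add_one h1.ne', sub_add_cancel]
    simp only [id, e1, Real.rpow_add_one h2.ne', Real.rpow_add_one h3.ne', add_sub_cancel_right]
    ring
  · exact intervalIntegrable_euler_mul hβ ha ht0 ht1 (by fun_prop)

lemma eulerIntegral_add_one_left {β a b t : ℝ} (ha : -1 < a) (ht0 : 0 < t) :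
    eulerIntegral β (a + 1) b t =
      ∫ s in (0 : ℝ)..t, (t - s) ^ (β - 1) * (s ^ a * (1 - s) ^ b) * s := by
  refine intervalIntegral.integral_congr fun s hs => ?_
  rw [Set.uIcc_of_le ht0.le] at hs
  simp only [Real.rpow_add_one' hs.1 (show a + 1 ≠ 0 by linarith)]
  ring

lemma eulerIntegral_add_two_left {β a b t : ℝ} (ha : -1 < a) (ht0 : 0 < t) :
    eulerIntegral β (a + 2) b t =
      ∫ s in (0 : ℝ)..t, (t - s) ^ (β - 1) * (s ^ a * (1 - s) ^ b) * s ^ 2 := by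
  rw [show a + 2 = a + 1 + 1 by ring, eulerIntegral_add_one_left (by linarith) ht0]
  refine intervalIntegral.integral_congr fun s hs => ?_
  rw [Set.uIcc_of_le ht0.le] at hs
  simp only [Real.rpow_add_one' hs.1 (show a + 1 ≠ 0 by linarith)]
  ring

lemma eulerIntegral_add_one_right {β a b t : ℝ} (ht0 : 0 < t) (ht1 : t < 1) :
    eulerIntegral β a (b + 1) t =
      ∫ s in (0 : ℝ)..t, (t - s) ^ (β - 1) * (s ^ a * (1 - s) ^ b) * (1 - s) := by
  refine intervalIntegral.integral_congr fun s hs => ?_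
  rw [Set.uIcc_of_le ht0.le] at hs
  simp only [Real.rpow_add_one (show 1 - s ≠ 0 by linarith [hs.2])]
  ring

lemma eulerIntegral_add_two_right {β a b t : ℝ} (ht0 : 0 < t) (ht1 : t < 1) :
    eulerIntegral β a (b + 2) t =
      ∫ s in (0 : ℝ)..t, (t - s) ^ (β - 1) * (s ^ a * (1 - s) ^ b) * (1 - s) ^ 2 := by
  rw [show b + 2 = b + 1 + 1 by ring, eulerIntegral_add_one_right ht0 ht1]
  refine intervalIntegral.integral_congr fun s hs => ?_
  rw [Set.uIcc_of_le ht0.le] at hs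
  simp only [Real.rpow_add_one (show 1 - s ≠ 0 by linarith [hs.2])]
  ring

/-- Expansion of an integral against a quadratic polynomial. -/
lemma integral_euler_mul_combination {β a b t : ℝ} (hβ : 0 < β) (ha : -1 < a)
    (ht0 : 0 < t) (ht1 : t < 1) {f g : ℝ → ℝ} (hf : Continuous f) (hg : Continuous g)
    (c₀ c₁ c₂ : ℝ) :
    ∫ s in (0 : ℝ)..t, (t - s) ^ (β - 1) * (s ^ a * (1 - s) ^ b) * (c₀ + c₁ * f s + c₂ * g s) =
      c₀ * eulerIntegral β a b t +
      c₁ * (∫ s in (0 : ℝ)..t, (t - s) ^ (β - 1) * (s ^ a * (1 - s) ^ b) * f s) +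
      c₂ * ∫ s in (0 : ℝ)..t, (t - s) ^ (β - 1) * (s ^ a * (1 - s) ^ b) * g s := by
  have i0 := intervalIntegrable_euler_mul (b := b) hβ ha ht0 ht1 (continuous_const (y := (1 : ℝ)))
  have i1 := intervalIntegrable_euler_mul (b := b) hβ ha ht0 ht1 hf
  have i2 := intervalIntegrable_euler_mul (b := b) hβ ha ht0 ht1 hg
  simp only [mul_one] at i0
  unfold eulerIntegral
  simp only [← intervalIntegral.integral_const_mul]
  rw [← intervalIntegral.integral_add (i0.const_mul _) (i1.const_mul _),
    ← intervalIntegral.integral_add ((i0.const_mul _).add (i1.const_mul _)) (i2.const_mul _)]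
  exact intervalIntegral.integral_congr fun s _ => by ring

lemma eulerIntegral_recurrence_left {β a b t : ℝ} (hβ : 0 < β) (ha : -1 < a)
    (ht0 : 0 < t) (ht1 : t < 1) :
    (a + b + β + 2) * eulerIntegral β (a + 2) b t =
      ((a + 1) * (1 + t) + (b + 1) * t + β) * eulerIntegral β (a + 1) b t -
        (a + 1) * t * eulerIntegral β a b t := by
  have h := integral_euler_mul_quadratic (b := b) hβ ha ht0 ht1
  have e := integral_euler_mul_combination (b := b) hβ ha ht0 ht1 (f := fun s => s)
    (g := fun s => s ^ 2) (by fun_prop) (by fun_prop) ((a + 1) * t)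
    (-((a + 1) * (1 + t) + (b + 1) * t + β)) (a + b + β + 2)
  rw [← eulerIntegral_add_one_left ha ht0, ← eulerIntegral_add_two_left ha ht0,
    intervalIntegral.integral_congr (g := fun s => (t - s) ^ (β - 1) * (s ^ a * (1 - s) ^ b) *
      ((a + 1) * (1 - s) * (t - s) - (b + 1) * s * (t - s) - β * s * (1 - s)))
      (fun s _ => by simp only; ring), h] at e
  linarith

lemma eulerIntegral_recurrence_right {β a b t : ℝ} (hβ : 0 < β) (ha : -1 < a)
    (ht0 : 0 < t) (ht1 : t < 1) :
    (a + b + β + 2) * eulerIntegral β a (b + 2) t =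
      ((b + 1) * (1 + (1 - t)) + (a + 1) * (1 - t) + β) * eulerIntegral β a (b + 1) t -
        (b + 1) * (1 - t) * eulerIntegral β a b t := by
  have h := integral_euler_mul_quadratic (b := b) hβ ha ht0 ht1
  have e := integral_euler_mul_combination (b := b) hβ ha ht0 ht1 (f := fun s => 1 - s)
    (g := fun s => (1 - s) ^ 2) (by fun_prop) (by fun_prop) ((b + 1) * (1 - t))
    (-((b + 1) * (1 + (1 - t)) + (a + 1) * (1 - t) + β)) (a + b + β + 2)
  rw [← eulerIntegral_add_one_right ht0 ht1, ← eulerIntegral_add_two_right ht0 ht1,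
    intervalIntegral.integral_congr (g := fun s => (t - s) ^ (β - 1) * (s ^ a * (1 - s) ^ b) *
      ((a + 1) * (1 - s) * (t - s) - (b + 1) * s * (t - s) - β * s * (1 - s)))
      (fun s _ => by simp only; ring), h] at e
  linarith

lemma integral_right_eq_eulerIntegral (β a b t : ℝ) :
    ∫ s in t..(1 : ℝ), (s - t) ^ (β - 1) * (s ^ a * (1 - s) ^ b) =
      eulerIntegral β b a (1 - t) := by
  have h := intervalIntegral.integral_comp_sub_left (a := 0) (b := 1 - t)
    (fun s => (s - t) ^ (β - 1) * (s ^ a * (1 - s) ^ b)) (1 : ℝ)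
  simp only [sub_sub_cancel, sub_zero] at h
  rw [← h, eulerIntegral]
  refine intervalIntegral.integral_congr fun s _ => ?_
  simp only [show 1 - s - t = 1 - t - s by ring]
  ring

lemma eulerIntegral_add_one_left_eq_sub {β a b t : ℝ} (hβ : 0 < β) (ha : -1 < a)
    (ht0 : 0 < t) (ht1 : t < 1) :
    eulerIntegral β (a + 1) b t = eulerIntegral β a b t - eulerIntegral β a (b + 1) t := by
  have e := integral_euler_mul_combination (b := b) hβ ha ht0 ht1 (f := fun s => 1 - s)
    (g := fun s => s) (by fun_prop) (by fun_prop) 1 (-1) 0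
  rw [← eulerIntegral_add_one_right ht0 ht1,
    intervalIntegral.integral_congr (g := fun s => (t - s) ^ (β - 1) * (s ^ a * (1 - s) ^ b) * s)
      (fun s _ => by simp only; ring), ← eulerIntegral_add_one_left ha ht0] at e
  linarith

lemma integral_rpow_mul_one_sub_rpow {u v : ℝ} (hu : 0 < u) (hv : 0 < v) :
    ∫ x in (0 : ℝ)..1, x ^ (u - 1) * (1 - x) ^ (v - 1) = ProbabilityTheory.beta u v := by
  rw [ProbabilityTheory.beta_eq_betaIntegralReal u v hu hv, Complex.betaIntegral]
  rw [intervalIntegral.integral_congr (g := fun x : ℝ =>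
    ((x ^ (u - 1) * (1 - x) ^ (v - 1) : ℝ) : ℂ)), intervalIntegral.integral_ofReal,
    Complex.ofReal_re]
  intro x hx
  rw [Set.uIcc_of_le zero_le_one] at hx
  simp only
  rw [Complex.ofReal_mul, Complex.ofReal_cpow hx.1, Complex.ofReal_cpow (sub_nonneg.2 hx.2)]
  push_cast
  rfl

/-- Evaluation in the homogeneous case, by a fractional linear substitution. -/
lemma eulerIntegral_homogeneous {β a b t : ℝ} (hβ : 0 < β) (ha : -1 < a) (hb : b = -β - a - 1)
    (ht0 : 0 < t) (ht1 : t < 1) :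
    eulerIntegral β a b t =
      ProbabilityTheory.beta (a + 1) β * t ^ (a + β) * (1 - t) ^ (-a - 1) := by
  have hD : ∀ v ∈ Set.Ioo (0 : ℝ) 1, 0 < 1 - t + t * v := fun v hv => by
    nlinarith [mul_pos ht0 hv.1]
  have himage : Set.image (fun v : ℝ => t * v / (1 - t + t * v)) (Set.Ioo 0 1) = Set.Ioo 0 t := by
    ext s
    constructor
    · rintro ⟨v, hv, rfl⟩
      have := hD v hv
      refine ⟨div_pos (mul_pos ht0 hv.1) this, ?_⟩
      rw [div_lt_iff₀ this]
      have := mul_pos ht0 (mul_pos (sub_pos.2 ht1) (sub_pos.2 hv.2))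
      nlinarith
    · intro hs
      have h1 : 0 < 1 - s := by linarith [hs.2]
      have h2 : 0 < t * (1 - s) := mul_pos ht0 h1
      refine ⟨s * (1 - t) / (t * (1 - s)),
        ⟨div_pos (mul_pos hs.1 (sub_pos.2 ht1)) h2, ?_⟩, ?_⟩
      · rw [div_lt_one h2]
        nlinarith [hs.2]
      · have h3 : 1 - t + t * (s * (1 - t) / (t * (1 - s))) = (1 - t) / (1 - s) := by
          field_simp
          ring
        have h4 : 1 - t ≠ 0 := by linarith
        simp only [h3]
        field_simp
  have hderiv : ∀ v ∈ Set.Ioo (0 : ℝ) 1, HasDerivWithinAt (fun v : ℝ => t * v / (1 - t + t * v))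
      (t * (1 - t) / (1 - t + t * v) ^ 2) (Set.Ioo 0 1) v := by
    intro v hv
    have d1 : HasDerivAt (fun v : ℝ => t * v) t v := by simpa using (hasDerivAt_id v).const_mul t
    refine ((d1.fun_div (d1.const_add (1 - t)) (hD v hv).ne').congr_deriv ?_).hasDerivWithinAt
    ring
  have hinj : Set.InjOn (fun v : ℝ => t * v / (1 - t + t * v)) (Set.Ioo 0 1) := by
    intro v hv w hw h
    simp only at h
    rw [div_eq_div_iff (hD v hv).ne' (hD w hw).ne'] at h
    have h4 : t * (1 - t) ≠ 0 := by
      have : 0 < 1 - t := by linarith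
      positivity
    refine mul_left_cancel₀ h4 ?_
    linarith
  rw [eulerIntegral, intervalIntegral.integral_of_le ht0.le, integral_Ioc_eq_integral_Ioo, ← himage,
    integral_image_eq_integral_abs_deriv_smul measurableSet_Ioo hderiv hinj]
  have hbeta := integral_rpow_mul_one_sub_rpow (show 0 < a + 1 by linarith) hβ
  rw [intervalIntegral.integral_of_le zero_le_one, integral_Ioc_eq_integral_Ioo] at hbeta
  rw [← hbeta, mul_assoc, ← integral_mul_const]
  refine setIntegral_congr_fun measurableSet_Ioo fun v hv => ?_
  have hD' := hD v hv
  have h1 : 0 < 1 - t := by linarith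
  have h2 : 0 < 1 - v := by linarith [hv.2]
  have h3 : 0 < v := hv.1
  have e1 : t - t * v / (1 - t + t * v) = t * (1 - t) * (1 - v) / (1 - t + t * v) := by
    field_simp
    ring
  have e2 : 1 - t * v / (1 - t + t * v) = (1 - t) / (1 - t + t * v) := by
    field_simp
    ring
  simp only [e1, e2]
  generalize 1 - t + t * v = D at *
  have h4 : 0 < t * (1 - t) / D ^ 2 := by positivity
  rw [abs_of_pos h4, smul_eq_mul, Real.div_rpow (by positivity) hD'.le,
    Real.div_rpow (by positivity) hD'.le, Real.div_rpow (by positivity) hD'.le,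
    Real.mul_rpow (by positivity) h2.le, Real.mul_rpow ht0.le h1.le, Real.mul_rpow ht0.le h3.le,
    hb, add_sub_cancel_right]
  have x1 : ∀ x : ℝ, 0 < x → x ^ (-β - a - 1) = (x ^ (β - 1))⁻¹ * (x ^ a)⁻¹ * (x ^ 2)⁻¹ := by
    intro x hx
    rw [show -β - a - 1 = -(β - 1) + -a + -(2 : ℕ) by push_cast; ring, Real.rpow_add hx,
      Real.rpow_add hx, Real.rpow_neg hx.le, Real.rpow_neg hx.le, Real.rpow_neg hx.le,
      Real.rpow_natCast]
  have x2 : t ^ (a + β) = t ^ a * t ^ (β - 1) * t := by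
    rw [show a + β = a + (β - 1) + 1 by ring, Real.rpow_add_one ht0.ne', Real.rpow_add ht0]
  have x3 : (1 - t) ^ (-a - 1) = ((1 - t) ^ a)⁻¹ * (1 - t)⁻¹ := by
    rw [show -a - 1 = -a + -1 by ring, Real.rpow_add h1, Real.rpow_neg h1.le, Real.rpow_neg_one]
  rw [x1 _ h1, x1 _ hD', x2, x3]
  have := (Real.rpow_pos_of_pos h1 a).ne'
  have := (Real.rpow_pos_of_pos h1 (β - 1)).ne'
  have := (Real.rpow_pos_of_pos hD' a).ne'
  have := (Real.rpow_pos_of_pos hD' (β - 1)).ne'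
  field_simp

lemma eulerIntegral_eq_rpow_mul (β a b : ℝ) {t : ℝ} (ht0 : 0 < t) :
    eulerIntegral β a b t = t ^ (a + β) *
      ∫ u in (0 : ℝ)..1, (1 - u) ^ (β - 1) * (u ^ a * (1 - t * u) ^ b) := by
  have h := intervalIntegral.mul_integral_comp_mul_left (a := 0) (b := 1)
    (f := fun s => (t - s) ^ (β - 1) * (s ^ a * (1 - s) ^ b)) t
  rw [mul_zero, mul_one] at h
  rw [eulerIntegral, ← h, ← intervalIntegral.integral_const_mul,
    ← intervalIntegral.integral_const_mul]
  refine intervalIntegral.integral_congr fun u hu => ?_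
  rw [Set.uIcc_of_le zero_le_one] at hu
  have h1 : 0 ≤ 1 - u := sub_nonneg.2 hu.2
  rw [show t - t * u = t * (1 - u) by ring, Real.mul_rpow ht0.le h1, Real.mul_rpow ht0.le hu.1,
    show a + β = a + (β - 1) + 1 by ring, Real.rpow_add_one ht0.ne', Real.rpow_add ht0]
  ring

lemma one_sub_mul_pos {x u : ℝ} (hx : x < 1) (hu0 : 0 ≤ u) (hu1 : u ≤ 1) : 0 < 1 - x * u := by
  rcases hu0.eq_or_lt with rfl | hu
  · simp
  · nlinarith [mul_pos hu (sub_pos.2 hx)]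

lemma intervalIntegrable_rpow_mul_one_sub_mul_rpow {c t u : ℝ} (d : ℝ) (hc : 0 < c) (ht0 : 0 < t)
    (ht1 : t < 1) (hu0 : 0 ≤ u) (hu1 : u ≤ 1) :
    IntervalIntegrable (fun x => x ^ (c - 1) * (1 - x * u) ^ d) volume 0 t := by
  refine (intervalIntegral.intervalIntegrable_rpow' (by linarith)).mul_continuousOn ?_
  refine ContinuousOn.rpow_const (by fun_prop) fun x hx => Or.inl ?_
  rw [Set.uIcc_of_le ht0.le] at hx
  exact (one_sub_mul_pos (by linarith [hx.2]) hu0 hu1).ne'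

lemma integral_rpow_mul_one_sub_mul_rpow {c t u : ℝ} (hc : 0 < c) (ht0 : 0 < t) (ht1 : t < 1)
    (hu0 : 0 ≤ u) (hu1 : u ≤ 1) :
    ∫ x in (0 : ℝ)..t, c * (x ^ (c - 1) * (1 - x * u) ^ (-c - 1)) =
      t ^ c * (1 - t * u) ^ (-c) := by
  have hpos : ∀ x ∈ Set.Icc 0 t, 0 < 1 - x * u := fun x hx =>
    one_sub_mul_pos (by linarith [hx.2]) hu0 hu1
  rw [intervalIntegral.integral_eq_sub_of_hasDerivAt_of_le ht0.le
    (f := fun x => x ^ c * (1 - x * u) ^ (-c))]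
  · simp [Real.zero_rpow hc.ne']
  · refine ContinuousOn.mul ?_ ?_
    · exact ContinuousOn.rpow_const (by fun_prop) fun x _ => Or.inr hc.le
    · exact ContinuousOn.rpow_const (by fun_prop) fun x hx => Or.inl (hpos x hx).ne'
  · intro x hx
    have h1 := hpos x (Set.Ioo_subset_Icc_self hx)
    have d1 := (hasDerivAt_id x).rpow_const (p := c) (Or.inl hx.1.ne')
    have d2 := (((hasDerivAt_id x).mul_const u).const_sub 1).rpow_const (p := -c) (Or.inl h1.ne')
    refine (d1.fun_mul d2).congr_deriv ?_
    have e1 : x ^ c = x ^ (c - 1) * x := by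
      rw [← Real.rpow_add_one hx.1.ne', sub_add_cancel]
    have e2 : (1 - x * u) ^ (-c) = (1 - x * u) ^ (-c - 1) * (1 - x * u) := by
      rw [← Real.rpow_add_one h1.ne', sub_add_cancel]
    simp only [id, e1, e2]
    ring
  · exact (intervalIntegrable_rpow_mul_one_sub_mul_rpow _ hc ht0 ht1 hu0 hu1).const_mul _

/-- When the exponents satisfy `a + b + β = 0`, the Euler integral is an incomplete beta
integral. -/
lemma eulerIntegral_eq_incompleteBeta {β a b t : ℝ} (hβ : 0 < β) (ha : -1 < a) (hb : b < 0)
    (hab : a + b + β = 0) (ht0 : 0 < t) (ht1 : t < 1) :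
    eulerIntegral β a b t = -b * ProbabilityTheory.beta (a + 1) β *
      ∫ x in (0 : ℝ)..t, x ^ (-b - 1) * (1 - x) ^ (-a - 1) := by
  have hc : 0 < -b := by linarith
  set F : ℝ × ℝ → ℝ := fun z => (1 - z.2) ^ (β - 1) * z.2 ^ a *
    (-b * (z.1 ^ (-b - 1) * (1 - z.1 * z.2) ^ (-(-b) - 1))) with hF
  have hFm : Measurable F := by fun_prop
  have hinner : ∀ u ∈ Set.Ioc (0 : ℝ) 1, ∫ x in Set.Ioc 0 t, F (x, u) =
      t ^ (-b) * ((1 - u) ^ (β - 1) * (u ^ a * (1 - t * u) ^ b)) := by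
    intro u hu
    simp only [hF]
    rw [integral_const_mul, ← intervalIntegral.integral_of_le ht0.le,
      integral_rpow_mul_one_sub_mul_rpow hc ht0 ht1 hu.1.le hu.2, neg_neg]
    ring
  have hnorm : ∀ u ∈ Set.Ioc (0 : ℝ) 1, ∀ x ∈ Set.Ioc (0 : ℝ) t, ‖F (x, u)‖ = F (x, u) := by
    intro u hu x hx
    refine Real.norm_of_nonneg ?_
    have h1 := one_sub_mul_pos (hx.2.trans_lt ht1) hu.1.le hu.2
    have h2 : 0 ≤ 1 - u := by linarith [hu.2]
    have h3 := hu.1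
    have h4 := hx.1
    simp only [hF]
    positivity
  have hint : Integrable F ((volume.restrict (Set.Ioc 0 t)).prod
      (volume.restrict (Set.Ioc (0 : ℝ) 1))) := by
    rw [integrable_prod_iff' hFm.aestronglyMeasurable]
    constructor
    · filter_upwards [ae_restrict_mem measurableSet_Ioc] with u hu
      have := (intervalIntegrable_rpow_mul_one_sub_mul_rpow (-(-b) - 1) hc ht0 ht1 hu.1.le hu.2).1
      exact (this.const_mul (-b)).const_mul ((1 - u) ^ (β - 1) * u ^ a)
    · have h0 : IntegrableOn (fun u : ℝ => t ^ (-b) * ((1 - u) ^ (β - 1) *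
          (u ^ a * (1 - t * u) ^ b))) (Set.Ioc 0 1) := by
        have hcont : ContinuousOn (fun u : ℝ => (1 - t * u) ^ b) (Set.uIcc 0 1) := by
          refine ContinuousOn.rpow_const (by fun_prop) fun u hu => Or.inl ?_
          rw [Set.uIcc_of_le zero_le_one] at hu
          exact (one_sub_mul_pos ht1 hu.1 hu.2).ne'
        have := ((intervalIntegrable_sub_rpow_mul_rpow hβ ha one_pos).mul_continuousOn hcont).1
        refine (this.congr ?_).const_mul _
        exact Filter.Eventually.of_forall fun u => by ring
      refine Integrable.congr h0 ?_
      filter_upwards [ae_restrict_mem measurableSet_Ioc] with u hu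
      rw [← hinner u hu]
      exact setIntegral_congr_fun measurableSet_Ioc fun x hx => (hnorm u hu x hx).symm
  have hswap := integral_integral_swap (f := fun x u => F (x, u)) hint
  rw [setIntegral_congr_fun measurableSet_Ioc hinner, integral_const_mul,
    ← intervalIntegral.integral_of_le zero_le_one,
    show -b = a + β by linarith, ← eulerIntegral_eq_rpow_mul β a b ht0] at hswap
  rw [← hswap, ← intervalIntegral.integral_of_le ht0.le, ← intervalIntegral.integral_const_mul]
  refine intervalIntegral.integral_congr_ae ?_
  refine Filter.Eventually.of_forall fun x hx => ?_
  rw [Set.uIoc_of_le ht0.le] at hx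
  have hx1 : x < 1 := by linarith [hx.2]
  have e := eulerIntegral_homogeneous (b := b - 1) hβ ha (by linarith) hx.1 hx1
  rw [eulerIntegral_eq_rpow_mul _ _ _ hx.1] at e
  have hxp := Real.rpow_pos_of_pos hx.1 (a + β)
  have euler_eval : ∫ u in (0 : ℝ)..1, (1 - u) ^ (β - 1) * (u ^ a * (1 - x * u) ^ (b - 1)) =
      ProbabilityTheory.beta (a + 1) β * (1 - x) ^ (-a - 1) := by
    refine mul_left_cancel₀ hxp.ne' ?_
    rw [e]
    ring
  have e2 : ∀ u, F (x, u) = (-b * x ^ (-b - 1)) *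
      ((1 - u) ^ (β - 1) * (u ^ a * (1 - x * u) ^ (b - 1))) := by
    intro u
    simp only [hF, neg_neg]
    ring
  simp only [e2]
  rw [integral_const_mul, ← intervalIntegral.integral_of_le zero_le_one, euler_eval]
  ring

/-- The power series `∑ Γ(a + n) / n! * tⁿ Xⁿ`, a multiple of `(1 - t X)^(-a)`. -/
def gammaSeries (a t : ℝ) : PowerSeries ℝ :=
  PowerSeries.mk fun n => Real.Gamma (a + n) / n.factorial * t ^ n

open PowerSeries in
lemma coeff_X_mul_derivative (f : PowerSeries ℝ) (n : ℕ) :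
    coeff n (X * d⁄dX ℝ f) = n * coeff n f := by
  cases n with
  | zero => simp
  | succ n =>
    rw [coeff_succ_X_mul, coeff_derivative]
    push_cast
    ring

open PowerSeries in
lemma gammaSeries_ode {a : ℝ} (ha : 0 < a) (t : ℝ) :
    (1 - C t * X) * d⁄dX ℝ (gammaSeries a t) = C (a * t) * gammaSeries a t := by
  ext n
  rw [sub_mul, one_mul, mul_assoc, map_sub, coeff_C_mul, coeff_C_mul, coeff_X_mul_derivative,
    coeff_derivative]
  simp only [gammaSeries, coeff_mk]
  have h : a + n ≠ 0 := by positivity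
  rw [Nat.factorial_succ]
  push_cast
  rw [← add_assoc, Real.Gamma_add_one h, pow_succ]
  field_simp
  ring

open PowerSeries in
lemma gammaSeries_mul_recurrence {a b : ℝ} (ha : 0 < a) (hb : 0 < b) (t : ℝ) (k : ℕ) :
    (k + 2) * coeff (k + 2) (gammaSeries a t * gammaSeries b 1) =
      (k + 1 + b + (k + 1 + a) * t) * coeff (k + 1) (gammaSeries a t * gammaSeries b 1) -
        (k + a + b) * t * coeff k (gammaSeries a t * gammaSeries b 1) := by
  have h1 := gammaSeries_ode ha t
  have h2 := gammaSeries_ode hb 1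
  set P := gammaSeries a t
  set Q := gammaSeries b 1
  have hode : d⁄dX ℝ (P * Q) + C t * (X * (X * d⁄dX ℝ (P * Q))) + C (a * t + b * t) * (X * (P * Q))
      = C (1 + t) * (X * d⁄dX ℝ (P * Q)) + C (a * t + b) * (P * Q) := by
    rw [Derivation.leibniz, smul_eq_mul, smul_eq_mul]
    simp only [map_add, map_mul, map_one] at h1 h2 ⊢
    linear_combination (1 - C t * X) * P * h2 + (1 - X) * Q * h1
  have h := congrArg (coeff (k + 1)) hode
  simp only [map_add, map_one, add_mul, one_mul, coeff_C_mul, coeff_succ_X_mul,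
    coeff_X_mul_derivative, coeff_derivative] at h
  push_cast at h
  linarith

lemma Gamma_ratio_eq {μ : ℝ} (h0 : -1 < μ) (h1 : μ < 0) (m : ℕ) :
    (-1 : ℝ) ^ m * Real.Gamma (μ + 1) / Real.Gamma (μ + 1 - m) =
      Real.Gamma (-μ + m) / Real.Gamma (-μ) := by
  have r1 := Real.Gamma_mul_Gamma_one_sub (-μ + m)
  have r2 := Real.Gamma_mul_Gamma_one_sub (-μ)
  have hs : Real.sin (π * -μ) ≠ 0 :=
    (Real.sin_pos_of_pos_of_lt_pi (by nlinarith [Real.pi_pos]) (by nlinarith [Real.pi_pos])).ne'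
  rw [mul_add, mul_comm π (m : ℝ), Real.sin_add_nat_mul_pi,
    show 1 - (-μ + m) = μ + 1 - m by ring] at r1
  rw [show 1 - -μ = μ + 1 by ring] at r2
  have g1 : Real.Gamma (-μ) ≠ 0 := (Real.Gamma_pos_of_pos (by linarith)).ne'
  have hm : ((-1 : ℝ) ^ m) * (-1) ^ m = 1 := by rw [← mul_pow]; simp
  have hm' : ((-1 : ℝ) ^ m) ≠ 0 := by simp
  have g3 : Real.Gamma (μ + 1 - m) ≠ 0 := by
    intro h
    rw [h, mul_zero] at r1
    exact (div_ne_zero Real.pi_ne_zero (mul_ne_zero hm' hs)) r1.symm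
  rw [div_eq_div_iff g3 g1, r1, mul_assoc, mul_comm (Real.Gamma (μ + 1)), r2,
    eq_div_iff (mul_ne_zero hm' hs)]
  linear_combination (-1 : ℝ) ^ m * (-1) ^ m * div_mul_cancel₀ π hs + π * hm

lemma sum_acoef_eq_coeff {α μ ν : ℝ} (h0 : -1 < μ) (h1 : μ < 0) (hsum : μ + ν = α - 2)
    (k : ℕ) (t : ℝ) :
    ∑ j ∈ Finset.range (k + 1), acoef α μ ν k j * t ^ j =
      PowerSeries.coeff k (gammaSeries (α - 1) t * gammaSeries (-μ) 1) / Real.Gamma (-μ) := by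
  rw [PowerSeries.coeff_mul, Finset.Nat.sum_antidiagonal_eq_sum_range_succ_mk, Finset.sum_div]
  refine Finset.sum_congr rfl fun j hj => ?_
  obtain ⟨m, rfl⟩ := Nat.exists_eq_add_of_le (Nat.lt_succ_iff.1 (Finset.mem_range.1 hj))
  simp only [gammaSeries, PowerSeries.coeff_mk, add_tsub_cancel_left, one_pow, mul_one, acoef]
  have hr := Gamma_ratio_eq h0 h1 m
  have e1 : (-1 : ℝ) ^ (j + m + j) = (-1) ^ m := by
    rw [show j + m + j = m + 2 * j by ring, pow_add, pow_mul]
    simp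
  rw [e1, Nat.cast_add, show α - 1 - ν - (j + m : ℝ) + j = μ + 1 - m by linarith,
    show (j + m : ℝ) + 1 - j = m + 1 by ring, Real.Gamma_nat_eq_factorial,
    Real.Gamma_nat_eq_factorial, show (j : ℝ) + α - 1 = α - 1 + j by ring]
  calc _ = (-1 : ℝ) ^ m * Real.Gamma (μ + 1) / Real.Gamma (μ + 1 - m) *
        (Real.Gamma (α - 1 + j) / j.factorial * t ^ j / m.factorial) := by
        simp only [div_eq_mul_inv, mul_inv]
        ring
    _ = _ := by
        rw [hr]
        ring

/-- The combination of left and right Euler integrals appearing in the theorem. -/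
def twoSidedIntegral (p β μ ν : ℝ) (k : ℕ) (t : ℝ) : ℝ :=
  p * eulerIntegral β (ν + k) μ t + (1 - p) * eulerIntegral β μ (ν + k) (1 - t)

lemma twoSidedIntegral_recurrence {β μ ν t : ℝ} (p : ℝ) (hβ : 0 < β) (hμ : -1 < μ) (hν : -1 < ν)
    (hsum : μ + ν + β = 0) (ht0 : 0 < t) (ht1 : t < 1) (k : ℕ) :
    (k + 2) * twoSidedIntegral p β μ ν (k + 2) t =
      (k + 1 - μ + (k + 2 - β) * t) * twoSidedIntegral p β μ ν (k + 1) t -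
        (k + 1 - β - μ) * t * twoSidedIntegral p β μ ν k t := by
  have hk : (0 : ℝ) ≤ k := k.cast_nonneg
  have hL := eulerIntegral_recurrence_left (a := ν + k) (b := μ) hβ (by linarith) ht0 ht1
  have hR := eulerIntegral_recurrence_right (a := μ) (b := ν + k) (t := 1 - t) hβ hμ
    (by linarith) (by linarith)
  obtain rfl : ν = -β - μ := by linarith
  simp only [twoSidedIntegral, Nat.cast_add, Nat.cast_ofNat, Nat.cast_one, ← add_assoc]
  linear_combination p * hL + (1 - p) * hR

lemma neg_mul_beta {β μ ν : ℝ} (hμ : μ < 0) (hsum : μ + ν + β = 0) :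
    -μ * ProbabilityTheory.beta (ν + 1) β =
      Real.Gamma (ν + 1) * Real.Gamma β / Real.Gamma (-μ) := by
  have g : Real.Gamma (-μ) ≠ 0 := (Real.Gamma_pos_of_pos (by linarith)).ne'
  have : μ ≠ 0 := hμ.ne
  rw [ProbabilityTheory.beta, show ν + 1 + β = -μ + 1 by linarith,
    Real.Gamma_add_one (s := -μ) (by linarith)]
  field_simp

lemma Gamma_neg_mul_Gamma_add_one (x : ℝ) :
    Real.Gamma (-x) * Real.Gamma (x + 1) = -π / Real.sin (π * x) := by
  have := Real.Gamma_mul_Gamma_one_sub (-x)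
  rw [mul_neg, Real.sin_neg, show 1 - -x = x + 1 by ring] at this
  rw [this, div_neg, neg_div]

lemma balance_beta {p β μ ν : ℝ} (hβ : 0 < β) (hμ1 : -1 < μ) (hν1 : -1 < ν) (hμ : μ < 0)
    (hν : ν < 0) (hsum : μ + ν + β = 0)
    (hbal : p * Real.sin (π * μ) = (1 - p) * Real.sin (π * ν)) :
    p * (μ * ProbabilityTheory.beta (ν + 1) β) =
      (1 - p) * (ν * ProbabilityTheory.beta (μ + 1) β) := by
  have h1 := neg_mul_beta hμ hsum
  have h2 := neg_mul_beta (μ := ν) (ν := μ) (β := β) hν (by linarith)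
  have r1 := Gamma_neg_mul_Gamma_add_one μ
  have r2 := Gamma_neg_mul_Gamma_add_one ν
  have hs : ∀ x, -1 < x → x < 0 → Real.sin (π * x) ≠ 0 := fun x hx1 hx2 =>
    (Real.sin_neg_of_neg_of_neg_pi_lt (by nlinarith [Real.pi_pos])
      (by nlinarith [Real.pi_pos])).ne
  have s1 := hs μ hμ1 hμ
  have s2 := hs ν hν1 hν
  have g1 : Real.Gamma (-μ) ≠ 0 := (Real.Gamma_pos_of_pos (by linarith)).ne'
  have g2 : Real.Gamma (-ν) ≠ 0 := (Real.Gamma_pos_of_pos (by linarith)).ne'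
  have key : p * (Real.Gamma (-ν) * Real.Gamma (ν + 1)) =
      (1 - p) * (Real.Gamma (-μ) * Real.Gamma (μ + 1)) := by
    rw [r1, r2]
    field_simp
    linear_combination -hbal
  have : p * (-μ * ProbabilityTheory.beta (ν + 1) β) =
      (1 - p) * (-ν * ProbabilityTheory.beta (μ + 1) β) := by
    rw [h1, h2]
    field_simp
    linear_combination key
  linarith

lemma twoSidedIntegral_one {p β μ ν t : ℝ} (hβ : 0 < β) (hμ1 : -1 < μ) (hν1 : -1 < ν) (hμ : μ < 0)
    (hν : ν < 0) (hsum : μ + ν + β = 0)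
    (hbal : p * Real.sin (π * μ) = (1 - p) * Real.sin (π * ν)) (ht0 : 0 < t) (ht1 : t < 1) :
    twoSidedIntegral p β μ ν 1 t = (-μ + (1 - β) * t) * twoSidedIntegral p β μ ν 0 t := by
  have hb := balance_beta hβ hμ1 hν1 hμ hν hsum hbal
  have l1 := eulerIntegral_add_one_left_eq_sub (b := μ) hβ hν1 ht0 ht1
  have l2 := eulerIntegral_recurrence_right (a := ν) (b := μ - 1) hβ hν1 ht0 ht1
  have l3 := eulerIntegral_homogeneous (b := μ - 1) hβ hν1 (by linarith) ht0 ht1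
  have r2 := eulerIntegral_recurrence_right (a := μ) (b := ν - 1) (t := 1 - t) hβ hμ1
    (by linarith) (by linarith)
  have r3 := eulerIntegral_homogeneous (a := μ) (b := ν - 1) (t := 1 - t) hβ hμ1 (by linarith)
    (by linarith) (by linarith)
  rw [show ν - 1 + 2 = ν + 1 by ring, sub_add_cancel] at r2
  rw [show μ - 1 + 2 = μ + 1 by ring, sub_add_cancel] at l2
  have h1 : 0 < 1 - t := by linarith
  have e1 : (1 - t) * (t ^ (ν + β) * (1 - t) ^ (-ν - 1)) = t ^ (-μ) * (1 - t) ^ (-ν) := by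
    rw [show ν + β = -μ by linarith, Real.rpow_sub_one h1.ne']
    field_simp
  have e2 : t * ((1 - t) ^ (μ + β) * (1 - (1 - t)) ^ (-μ - 1)) = t ^ (-μ) * (1 - t) ^ (-ν) := by
    rw [show μ + β = -ν by linarith, sub_sub_cancel, Real.rpow_sub_one ht0.ne']
    field_simp
  obtain rfl : β = -μ - ν := by linarith
  simp only [twoSidedIntegral, Nat.cast_one, Nat.cast_zero, add_zero]
  rw [l3] at l2
  rw [r3] at r2
  rw [l1]
  linear_combination (-p) * l2 + (1 - p) * r2 + t ^ (-μ) * (1 - t) ^ (-ν) * hb +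
    p * μ * ProbabilityTheory.beta (ν + 1) (-μ - ν) * e1 -
    (1 - p) * ν * ProbabilityTheory.beta (μ + 1) (-μ - ν) * e2

lemma twoSidedIntegral_zero {p β μ ν t : ℝ} (hβ : 0 < β) (hμ1 : -1 < μ) (hν1 : -1 < ν) (hμ : μ < 0)
    (hν : ν < 0) (hsum : μ + ν + β = 0)
    (hbal : p * Real.sin (π * μ) = (1 - p) * Real.sin (π * ν)) (ht0 : 0 < t) (ht1 : t < 1) :
    twoSidedIntegral p β μ ν 0 t = p * (-π / Real.sin (π * ν)) := by
  have hb := balance_beta hβ hμ1 hν1 hμ hν hsum hbal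
  have hL := eulerIntegral_eq_incompleteBeta hβ hν1 hμ (by linarith) ht0 ht1
  have hR := eulerIntegral_eq_incompleteBeta (a := μ) (b := ν) (t := 1 - t) hβ hμ1 hν
    (by linarith) (by linarith) (by linarith)
  have hrev := intervalIntegral.integral_comp_sub_left (a := 0) (b := 1 - t)
    (fun x => x ^ (-μ - 1) * (1 - x) ^ (-ν - 1)) (1 : ℝ)
  simp only [sub_sub_cancel, sub_zero] at hrev
  have hcomm : ∫ x in (0 : ℝ)..(1 - t), x ^ (-ν - 1) * (1 - x) ^ (-μ - 1) =
      ∫ x in t..(1 : ℝ), x ^ (-μ - 1) * (1 - x) ^ (-ν - 1) := by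
    rw [← hrev]
    exact intervalIntegral.integral_congr fun x _ => mul_comm _ _
  have hi : IntervalIntegrable (fun x : ℝ => x ^ (-μ - 1) * (1 - x) ^ (-ν - 1)) volume 0 1 :=
    (intervalIntegrable_sub_rpow_mul_rpow (β := -ν) (a := -μ - 1) (by linarith) (by linarith)
      one_pos).congr fun x _ => mul_comm _ _
  have hadd := intervalIntegral.integral_add_adjacent_intervals
    (hi.mono_set (c := 0) (d := t) ?_) (hi.mono_set (c := t) (d := 1) ?_)
  rotate_left
  · rw [Set.uIcc_of_le ht0.le, Set.uIcc_of_le zero_le_one]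
    exact Set.Icc_subset_Icc le_rfl ht1.le
  · rw [Set.uIcc_of_le ht1.le, Set.uIcc_of_le zero_le_one]
    exact Set.Icc_subset_Icc ht0.le le_rfl
  rw [integral_rpow_mul_one_sub_rpow (by linarith) (by linarith)] at hadd
  have hnb := neg_mul_beta hμ hsum
  have hfinal : -μ * ProbabilityTheory.beta (ν + 1) β * ProbabilityTheory.beta (-μ) (-ν) =
      -π / Real.sin (π * ν) := by
    have g1 : Real.Gamma (-μ) ≠ 0 := (Real.Gamma_pos_of_pos (by linarith)).ne'
    have g2 : Real.Gamma β ≠ 0 := (Real.Gamma_pos_of_pos hβ).ne'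
    rw [hnb, ProbabilityTheory.beta, show -μ + -ν = β by linarith, ← Gamma_neg_mul_Gamma_add_one]
    field_simp
  simp only [twoSidedIntegral, Nat.cast_zero, add_zero]
  rw [hL, hR, hcomm, ← hfinal, ← hadd]
  linear_combination (∫ x in t..(1 : ℝ), x ^ (-μ - 1) * (1 - x) ^ (-ν - 1)) * hb

lemma twoSidedIntegral_eq_coeff {p β μ ν t : ℝ} (hβ : 0 < β) (hμ1 : -1 < μ) (hν1 : -1 < ν)
    (hμ : μ < 0) (hν : ν < 0) (hsum : μ + ν + β = 0) (hβ1 : β < 1)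
    (hbal : p * Real.sin (π * μ) = (1 - p) * Real.sin (π * ν)) (ht0 : 0 < t) (ht1 : t < 1)
    (k : ℕ) :
    twoSidedIntegral p β μ ν k t * (Real.Gamma (1 - β) * Real.Gamma (-μ)) =
      p * (-π / Real.sin (π * ν)) *
        PowerSeries.coeff k (gammaSeries (1 - β) t * gammaSeries (-μ) 1) := by
  induction k using Nat.twoStepInduction with
  | zero =>
    rw [twoSidedIntegral_zero hβ hμ1 hν1 hμ hν hsum hbal ht0 ht1]
    simp [PowerSeries.coeff_mul, gammaSeries]
  | one =>
    rw [twoSidedIntegral_one hβ hμ1 hν1 hμ hν hsum hbal ht0 ht1,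
      twoSidedIntegral_zero hβ hμ1 hν1 hμ hν hsum hbal ht0 ht1]
    simp only [PowerSeries.coeff_mul, Finset.Nat.antidiagonal_succ, gammaSeries]
    simp [Real.Gamma_add_one (show 1 - β ≠ 0 by linarith),
      Real.Gamma_add_one (show -μ ≠ 0 by linarith)]
    ring
  | more k ih1 ih2 =>
    have h1 := twoSidedIntegral_recurrence p hβ hμ1 hν1 hsum ht0 ht1 k
    have h2 := gammaSeries_mul_recurrence (a := 1 - β) (b := -μ) (by linarith) (by linarith) t k
    have hk : (k : ℝ) + 2 ≠ 0 := by positivity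
    refine mul_left_cancel₀ hk ?_
    linear_combination (Real.Gamma (1 - β) * Real.Gamma (-μ)) * h1 -
      p * (-π / Real.sin (π * ν)) * h2 + (k + 1 - μ + (k + 2 - β) * t) * ih2 -
      (k + 1 - β - μ) * t * ih1

theorem statement0 (p α μ ν : ℝ)
    (hp0 : 0 < p) (hp1 : p < 1) (hα1 : 1 < α) (hα2 : α < 2)
    (hμ1 : α - 2 < μ) (hμ2 : μ < 0) (hν1 : α - 2 < ν) (hν2 : ν < 0)
    (hsum : μ + ν = α - 2)
    (hbal : p * Real.sin (π * μ) = (1 - p) * Real.sin (π * ν))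
    (k : ℕ) (t : ℝ) (ht : t ∈ Set.Ioo (0 : ℝ) 1) :
    Cap α μ ν *
        (p * I0l (2 - α) (fun s => s ^ (ν + (k : ℝ)) * (1 - s) ^ μ) t +
          (1 - p) * I0r (2 - α) (fun s => s ^ (ν + (k : ℝ)) * (1 - s) ^ μ) t) =
      ∑ j ∈ Finset.range (k + 1), acoef α μ ν k j * t ^ j := by
  obtain ⟨ht0, ht1⟩ := ht
  have hμ' : -1 < μ := by linarith
  have hν' : -1 < ν := by linarith
  have hT := twoSidedIntegral_eq_coeff (p := p) (β := 2 - α) (by linarith) hμ' hν' hμ2 hν2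
    (by linarith) (by linarith) hbal ht0 ht1 k
  have hint : p * I0l (2 - α) (fun s => s ^ (ν + (k : ℝ)) * (1 - s) ^ μ) t +
      (1 - p) * I0r (2 - α) (fun s => s ^ (ν + (k : ℝ)) * (1 - s) ^ μ) t =
      1 / Real.Gamma (2 - α) * twoSidedIntegral p (2 - α) μ ν k t := by
    simp only [I0l, I0r, integral_right_eq_eulerIntegral, twoSidedIntegral, eulerIntegral]
    ring
  rw [hint, sum_acoef_eq_coeff hμ' hμ2 hsum, Cap]
  rw [show 1 - (2 - α) = α - 1 by ring] at hT
  have hα := Gamma_neg_mul_Gamma_add_one (α - 2)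
  rw [neg_sub, show α - 2 + 1 = α - 1 by ring,
    show π * (α - 2) = π * α - 2 * π by ring, Real.sin_sub_two_pi] at hα
  have g1 : Real.Gamma (2 - α) ≠ 0 := (Real.Gamma_pos_of_pos (by linarith)).ne'
  have g2 : Real.Gamma (α - 1) ≠ 0 := (Real.Gamma_pos_of_pos (by linarith)).ne'
  have g3 : Real.Gamma (-μ) ≠ 0 := (Real.Gamma_pos_of_pos (by linarith)).ne'
  have sα : Real.sin (π * α) ≠ 0 := by
    intro h
    rw [h, div_zero] at hα
    exact mul_ne_zero g1 g2 hα
  have sν : Real.sin (π * ν) ≠ 0 :=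
    (Real.sin_neg_of_neg_of_neg_pi_lt (by nlinarith [Real.pi_pos])
      (by nlinarith [Real.pi_pos])).ne
  rw [eq_div_iff sα] at hα
  have hC : p * (Real.sin (π * μ) + Real.sin (π * ν)) = Real.sin (π * ν) := by linarith
  rw [← eq_div_iff (mul_ne_zero g2 g3)] at hT
  rw [hT]
  generalize PowerSeries.coeff k (gammaSeries (α - 1) t * gammaSeries (-μ) 1) = S
  field_simp
  linear_combination (-π * S) * hC - Real.sin (π * ν) * S * hα
end
end

section
/- Let 0 < p < 1, 1 < α < 2, and let μ, ν ∈ (α−2, 0) satisfy μ + ν = α − 2 and p·sin(πμ) = (1−p)·sin(πν); set C_{α,p} = (sin(πμ) + sin(πν))/sin(πα). Then for every integer n ≥ 0 and every t ∈ (0,1), C_{α,p}·( p·(₀I_t^{2−α} g_n)(t) + (1−p)·(ₜI_1^{2−α} g_n)(t) ) = (Γ(n+α−1)/Γ(n+1))·P_n^{ν,μ}(2t−1), where g_n(s) = s^ν (1−s)^μ P_n^{μ,ν}(2s−1). -/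
open MeasureTheory Real Set Finset

noncomputable section

/-- Jacobi polynomial `P_n^{a,b}` given by its explicit hypergeometric sum. -/
def jacobiP (n : ℕ) (a b : ℝ) (x : ℝ) : ℝ :=
  ∑ m ∈ Finset.range (n + 1),
    (Real.Gamma (a + n + 1) * Real.Gamma (a + b + n + m + 1)) /
      ((m.factorial : ℝ) * ((n - m).factorial : ℝ) * Real.Gamma (a + b + n + 1) *
        Real.Gamma (a + m + 1)) * ((x - 1) / 2) ^ m

theorem intervalIntegrable_rpow_mul_one_sub_rpow {a b : ℝ} (ha : -1 < a) (hb : -1 < b) :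
    IntervalIntegrable (fun x : ℝ => x ^ a * (1 - x) ^ b) volume 0 1 := by
  have left : ∀ {a b : ℝ}, -1 < a →
      IntervalIntegrable (fun x : ℝ => x ^ a * (1 - x) ^ b) volume 0 (1 / 2) := by
    intro a b ha
    refine (intervalIntegral.intervalIntegrable_rpow' ha).mul_continuousOn ?_
    intro x hx
    rw [Set.uIcc_of_le (by norm_num : (0 : ℝ) ≤ 1 / 2)] at hx
    exact (ContinuousAt.rpow_const (by fun_prop)
      (Or.inl (by linarith [hx.2]))).continuousWithinAt
  refine (left ha).trans ?_
  have := ((left (b := a) hb).comp_sub_left 1).symm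
  norm_num at this
  simpa [mul_comm] using this

theorem integral_rpow_mul_one_sub_rpow_s1 {a b : ℝ} (ha : -1 < a) (hb : -1 < b) :
    ∫ x in (0 : ℝ)..1, x ^ a * (1 - x) ^ b =
      Real.Gamma (a + 1) * Real.Gamma (b + 1) / Real.Gamma (a + b + 2) := by
  have h := Complex.betaIntegral_eq_Gamma_mul_div ((a + 1 : ℝ) : ℂ) ((b + 1 : ℝ) : ℂ)
    (by simp; linarith) (by simp; linarith)
  rw [← Complex.ofReal_add, Complex.Gamma_ofReal, Complex.Gamma_ofReal, Complex.Gamma_ofReal,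
    ← Complex.ofReal_mul, ← Complex.ofReal_div, Complex.betaIntegral] at h
  rw [show a + b + 2 = a + 1 + (b + 1) by ring, ← Complex.ofReal_inj, ← h,
    ← intervalIntegral.integral_ofReal]
  refine intervalIntegral.integral_congr fun x hx => ?_
  rw [Set.uIcc_of_le zero_le_one] at hx
  simp only [Complex.ofReal_mul]
  rw [Complex.ofReal_cpow hx.1, Complex.ofReal_cpow (by linarith [hx.2])]
  simp

/-- The unnormalised left Riemann–Liouville integral. -/
def rlInt (σ : ℝ) (φ : ℝ → ℝ) (t : ℝ) : ℝ := ∫ s in (0 : ℝ)..t, (t - s) ^ (σ - 1) * φ s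

theorem intervalIntegrable_rlInt_and_integral {σ : ℝ} (hσ : 0 < σ) {φ : ℝ → ℝ}
    (hφ : IntervalIntegrable φ volume 0 1) {t : ℝ} (ht0 : 0 ≤ t) (ht1 : t ≤ 1) :
    IntervalIntegrable (rlInt σ φ) volume 0 t ∧
      σ * ∫ τ in (0 : ℝ)..t, rlInt σ φ τ = ∫ s in (0 : ℝ)..t, (t - s) ^ σ * φ s := by
  set f : ℝ → ℝ := indicator (Ioc 0 1) φ with hf
  set g : ℝ → ℝ := indicator (Ioc 0 1) (fun x => x ^ (σ - 1)) with hg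
  have hfi : Integrable f := by
    rw [hf, integrable_indicator_iff measurableSet_Ioc]
    exact (intervalIntegrable_iff_integrableOn_Ioc_of_le zero_le_one).1 hφ
  have hgi : Integrable g := by
    rw [hg, integrable_indicator_iff measurableSet_Ioc]
    exact (intervalIntegrable_iff_integrableOn_Ioc_of_le zero_le_one).1
      (intervalIntegral.intervalIntegrable_rpow' (by linarith))
  have hprod : Integrable (fun p : ℝ × ℝ => f p.2 * g (p.1 - p.2))
      ((volume.restrict (Ioc 0 t)).prod (volume.restrict (Ioc 0 t))) := by
    rw [Measure.prod_restrict]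
    exact (hfi.convolution_integrand (ContinuousLinearMap.mul ℝ ℝ) hgi).integrableOn
  have hinner : ∀ τ ∈ Ioc 0 t, ∫ s in Ioc 0 t, f s * g (τ - s) = rlInt σ φ τ := by
    intro τ hτ
    have : EqOn (fun s => f s * g (τ - s))
        (indicator (Ioo 0 τ) (fun s => (τ - s) ^ (σ - 1) * φ s)) (Ioc 0 t) := by
      intro s hs
      have hs1 : s ∈ Ioc (0 : ℝ) 1 := ⟨hs.1, hs.2.trans ht1⟩
      by_cases h : s < τ
      · have h1 : τ - s ∈ Ioc (0 : ℝ) 1 := ⟨by linarith, by linarith [hτ.2, hs.1]⟩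
        have h2 : s ∈ Ioo 0 τ := ⟨hs.1, h⟩
        simp [hf, hg, hs1, h1, h2, mul_comm]
      · have h1 : τ - s ∉ Ioc (0 : ℝ) 1 := fun h' => h (by linarith [h'.1])
        have h2 : s ∉ Ioo 0 τ := fun h' => h h'.2
        simp [hg, h1, h2]
    rw [setIntegral_congr_fun measurableSet_Ioc this, setIntegral_indicator measurableSet_Ioo,
      Set.inter_eq_right.2 (Set.Ioo_subset_Ioc_self.trans (Set.Ioc_subset_Ioc_right hτ.2)), rlInt,
      intervalIntegral.integral_of_le hτ.1.le, integral_Ioc_eq_integral_Ioo]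
  have houter : ∀ s ∈ Ioc 0 t, ∫ τ in Ioc 0 t, f s * g (τ - s) = (t - s) ^ σ * φ s / σ := by
    intro s hs
    have hs1 : s ∈ Ioc (0 : ℝ) 1 := ⟨hs.1, hs.2.trans ht1⟩
    have : EqOn (fun τ => f s * g (τ - s))
        (indicator (Ioc s t) (fun τ => φ s * (τ - s) ^ (σ - 1))) (Ioc 0 t) := by
      intro τ hτ
      by_cases h : s < τ
      · have h1 : τ - s ∈ Ioc (0 : ℝ) 1 := ⟨by linarith, by linarith [hτ.2, hs.1]⟩
        have h2 : τ ∈ Ioc s t := ⟨h, hτ.2⟩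
        simp [hf, hg, hs1, h1, h2]
      · have h1 : τ - s ∉ Ioc (0 : ℝ) 1 := fun h' => h (by linarith [h'.1])
        have h2 : τ ∉ Ioc s t := fun h' => h h'.1
        simp [hg, h1, h2]
    rw [setIntegral_congr_fun measurableSet_Ioc this, setIntegral_indicator measurableSet_Ioc,
      Set.inter_eq_right.2 (Set.Ioc_subset_Ioc_left hs.1.le), ← intervalIntegral.integral_of_le hs.2,
      intervalIntegral.integral_const_mul,
      intervalIntegral.integral_comp_sub_right (fun x => x ^ (σ - 1)), sub_self,
      integral_rpow (Or.inl (by linarith))]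
    simp [hσ.ne']
    ring
  constructor
  · rw [intervalIntegrable_iff_integrableOn_Ioc_of_le ht0]
    exact hprod.integral_prod_left.congr
      ((ae_restrict_iff' measurableSet_Ioc).2 (Filter.Eventually.of_forall hinner))
  · rw [intervalIntegral.integral_of_le ht0, intervalIntegral.integral_of_le ht0,
      ← setIntegral_congr_fun measurableSet_Ioc hinner, integral_integral_swap hprod,
      setIntegral_congr_fun measurableSet_Ioc houter, integral_div]
    field_simp

/-- Euler's integral for `₂F₁(a + c + 2, a + 1; a + c + 2; t) = (1 - t) ^ (-a - 1)`. -/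
theorem integral_euler_degenerate (a c : ℝ) {t : ℝ} (ht0 : 0 ≤ t) (ht1 : t < 1) :
    ∫ x in (0 : ℝ)..1, x ^ a * (1 - x) ^ c * (1 - t * x) ^ (-a - c - 2) =
      (1 - t) ^ (-a - 1) * ∫ v in (0 : ℝ)..1, v ^ a * (1 - v) ^ c := by
  have ht : 0 < 1 - t := by linarith
  have hD : ∀ v ∈ Set.Ioo (0 : ℝ) 1, 0 < 1 - t + t * v := fun v hv => by
    nlinarith [mul_nonneg ht0 hv.1.le]
  have himage : (fun v : ℝ => v / (1 - t + t * v)) '' Set.Ioo 0 1 = Set.Ioo 0 1 := by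
    ext x
    constructor
    · rintro ⟨v, hv, rfl⟩
      have := hD v hv
      refine ⟨div_pos hv.1 this, (div_lt_one this).2 ?_⟩
      nlinarith [hv.2]
    · intro hx
      have hx1 : 0 < 1 - t * x := by nlinarith [hx.1, hx.2]
      refine ⟨(1 - t) * x / (1 - t * x), ⟨by have := hx.1; positivity, ?_⟩, ?_⟩
      · rw [div_lt_one hx1]
        nlinarith [hx.2]
      · have : 1 - t + t * ((1 - t) * x / (1 - t * x)) = (1 - t) / (1 - t * x) := by
          field_simp
          ring
        simp only [this]
        field_simp
  have hderiv : ∀ v ∈ Set.Ioo (0 : ℝ) 1,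
      HasDerivWithinAt (fun v : ℝ => v / (1 - t + t * v)) ((1 - t) / (1 - t + t * v) ^ 2)
        (Set.Ioo 0 1) v := by
    intro v hv
    have h := (hasDerivAt_id v).div (((hasDerivAt_id v).const_mul t).const_add (1 - t))
      (hD v hv).ne'
    refine (h.congr_deriv ?_).hasDerivWithinAt
    simp only [id]
    congr 1
    ring
  have hinj : Set.InjOn (fun v : ℝ => v / (1 - t + t * v)) (Set.Ioo 0 1) := by
    intro v hv w hw h
    have := hD v hv
    have := hD w hw
    simp only at h
    rw [div_eq_div_iff (by positivity) (by positivity)] at h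
    have : (1 - t) * (v - w) = 0 := by linear_combination h
    rcases mul_eq_zero.1 this with h | h <;> linarith
  have key := integral_image_eq_integral_abs_deriv_smul measurableSet_Ioo hderiv hinj
    (fun x => x ^ a * (1 - x) ^ c * (1 - t * x) ^ (-a - c - 2))
  rw [himage] at key
  rw [intervalIntegral.integral_of_le zero_le_one, intervalIntegral.integral_of_le zero_le_one,
    integral_Ioc_eq_integral_Ioo, integral_Ioc_eq_integral_Ioo, key, ← integral_const_mul]
  refine setIntegral_congr_fun measurableSet_Ioo fun v hv => ?_
  have hDv := hD v hv
  have hv1 : 0 < 1 - v := by linarith [hv.2]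
  simp only [smul_eq_mul]
  set D := 1 - t + t * v with hDdef
  have e1 : 1 - v / D = (1 - t) * (1 - v) / D := by
    field_simp
    rw [hDdef]
    ring
  have e2 : 1 - t * (v / D) = (1 - t) / D := by
    field_simp
    rw [hDdef]
    ring
  have hDpow : D ^ a * D ^ c * D ^ (-a - c - 2) * D ^ 2 = 1 := by
    rw [← rpow_natCast D 2, ← rpow_add hDv, ← rpow_add hDv, ← rpow_add hDv,
      show a + c + (-a - c - 2) + ((2 : ℕ) : ℝ) = 0 by push_cast; ring, rpow_zero]
  have htpow : (1 - t) ^ c * (1 - t) ^ (-a - c - 2) * (1 - t) = (1 - t) ^ (-a - 1) := by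
    nth_rewrite 3 [← rpow_one (1 - t)]
    rw [← rpow_add ht, ← rpow_add ht]
    congr 1
    ring
  rw [abs_of_pos (by positivity), e1, e2, div_rpow hv.1.le hDv.le,
    div_rpow (by positivity) hDv.le, div_rpow ht.le hDv.le, mul_rpow ht.le hv1.le, ← htpow]
  calc _ = (1 - t) ^ c * (1 - t) ^ (-a - c - 2) * (1 - t) * (v ^ a * (1 - v) ^ c) /
        (D ^ a * D ^ c * D ^ (-a - c - 2) * D ^ 2) := by
        field_simp
    _ = _ := by rw [hDpow, div_one]

theorem hasDerivAt_rlInt_jacobiWeight {σ a b t : ℝ} (hσ : 0 < σ) (ha : -1 < a) (hb : b < 0)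
    (hab : a + b = -σ) (ht : t ∈ Set.Ioo (0 : ℝ) 1) :
    HasDerivAt (rlInt σ (fun s => s ^ a * (1 - s) ^ b))
      (Real.Gamma (a + 1) * Real.Gamma σ / Real.Gamma (-b) *
        (t ^ (-b - 1) * (1 - t) ^ (-a - 1))) t := by
  have hscale : ∀ y ∈ Set.Ioo (0 : ℝ) 1, rlInt σ (fun s => s ^ a * (1 - s) ^ b) y =
      y ^ (-b) * ∫ x in (0 : ℝ)..1, x ^ a * (1 - x) ^ (σ - 1) * (1 - y * x) ^ b := by
    intro y hy
    have h := intervalIntegral.smul_integral_comp_mul_left (a := 0) (b := 1)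
      (fun s => (y - s) ^ (σ - 1) * (s ^ a * (1 - s) ^ b)) y
    rw [mul_zero, mul_one] at h
    rw [rlInt, ← h, smul_eq_mul, ← intervalIntegral.integral_const_mul,
      ← intervalIntegral.integral_const_mul]
    refine intervalIntegral.integral_congr_Ioo_of_le zero_le_one fun x hx => ?_
    have hpow : y * y ^ (σ - 1) * y ^ a = y ^ (-b) := by
      nth_rewrite 1 [← rpow_one y]
      rw [← rpow_add hy.1, ← rpow_add hy.1]
      congr 1
      linarith
    rw [show y - y * x = y * (1 - x) by ring, mul_rpow hy.1.le (by linarith [hx.2]),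
      mul_rpow hy.1.le hx.1.le, ← hpow]
    ring
  obtain ⟨r, htr, hr1⟩ := exists_between ht.2
  have hpos : ∀ y ∈ Set.Ioo 0 r, ∀ x ∈ Set.Ioc (0 : ℝ) 1, 1 - r < 1 - y * x := by
    intro y hy x hx
    nlinarith [hy.1, hy.2, hx.1, hx.2]
  have hint := intervalIntegrable_rpow_mul_one_sub_rpow ha (by linarith : -1 < σ - 1)
  have hcont : ∀ y ∈ Set.Ioo 0 r, ∀ e : ℝ,
      ContinuousOn (fun x => (1 - y * x) ^ e) (Set.uIcc (0 : ℝ) 1) := by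
    intro y hy e x hx
    rw [Set.uIcc_of_le zero_le_one] at hx
    refine (ContinuousAt.rpow_const (by fun_prop) (Or.inl ?_)).continuousWithinAt
    nlinarith [hy.1, hy.2, hx.1, hx.2]
  have htr' : t ∈ Set.Ioo 0 r := ⟨ht.1, htr⟩
  have hJ := (intervalIntegral.hasDerivAt_integral_of_dominated_loc_of_deriv_le
    (μ := volume) (a := 0) (b := 1) (x₀ := t) (s := Set.Ioo 0 r)
    (F := fun y x => x ^ a * (1 - x) ^ (σ - 1) * (1 - y * x) ^ b)
    (F' := fun y x => x ^ a * (1 - x) ^ (σ - 1) * (-x * b * (1 - y * x) ^ (b - 1)))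
    (bound := fun x => x ^ a * (1 - x) ^ (σ - 1) * (|b| * (1 - r) ^ (b - 1)))
    (Ioo_mem_nhds ht.1 htr)
    (Filter.Eventually.of_forall fun y => by
      refine Measurable.aestronglyMeasurable ?_
      fun_prop)
    (hint.mul_continuousOn (hcont t htr' b))
    (by
      refine Measurable.aestronglyMeasurable ?_
      fun_prop)
    (Filter.Eventually.of_forall fun x hx y hy => by
      rw [uIoc_of_le zero_le_one] at hx
      have h1 := hpos y hy x hx
      have h2 : 0 ≤ 1 - x := by linarith [hx.2]
      have h3 := hx.1
      rw [norm_mul, norm_mul, norm_mul, norm_mul, norm_eq_abs, norm_eq_abs, norm_eq_abs,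
        norm_eq_abs, norm_eq_abs, abs_neg, abs_of_pos hx.1, abs_of_nonneg (by positivity),
        abs_of_nonneg (by positivity), abs_of_nonneg (rpow_nonneg (by linarith) _)]
      have h4 : (1 - y * x) ^ (b - 1) ≤ (1 - r) ^ (b - 1) :=
        rpow_le_rpow_of_nonpos (by linarith) h1.le (by linarith)
      have h5 : x * |b| ≤ |b| := mul_le_of_le_one_left (abs_nonneg b) hx.2
      have h6 : 0 ≤ (1 - y * x) ^ (b - 1) := rpow_nonneg (by linarith) _
      gcongr)
    (hint.mul_const _)
    (Filter.Eventually.of_forall fun x hx y hy => by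
      rw [uIoc_of_le zero_le_one] at hx
      have h1 := hpos y hy x hx
      refine HasDerivAt.const_mul _ ?_
      have h2 : HasDerivAt (fun y => 1 - y * x) (-x) y := by
        simpa using ((hasDerivAt_id y).mul_const x).const_sub 1
      exact h2.rpow_const (Or.inl (by linarith)))).2
  have hW := (hasDerivAt_rpow_const (p := -b) (Or.inl ht.1.ne')).mul hJ
  refine (hW.congr_of_eventuallyEq (Filter.eventually_of_mem (Ioo_mem_nhds ht.1 ht.2)
    hscale)).congr_deriv ?_
  have heuler := integral_euler_degenerate a (σ - 1) ht.1.le ht.2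
  rw [show -a - (σ - 1) - 2 = b - 1 by linarith,
    integral_rpow_mul_one_sub_rpow_s1 ha (by linarith)] at heuler
  have hsplit : (∫ x in (0 : ℝ)..1, x ^ a * (1 - x) ^ (σ - 1) * (1 - t * x) ^ b) * -b +
      t * (∫ x in (0 : ℝ)..1, x ^ a * (1 - x) ^ (σ - 1) * (-x * b * (1 - t * x) ^ (b - 1))) =
      -b * ∫ x in (0 : ℝ)..1, x ^ a * (1 - x) ^ (σ - 1) * (1 - t * x) ^ (b - 1) := by
    rw [← intervalIntegral.integral_mul_const, ← intervalIntegral.integral_const_mul,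
      ← intervalIntegral.integral_const_mul, ← intervalIntegral.integral_add]
    · refine intervalIntegral.integral_congr_Ioo_of_le zero_le_one fun x hx => ?_
      have h1 := hpos t htr' x ⟨hx.1, hx.2.le⟩
      have h2 : (1 - t * x) ^ b = (1 - t * x) ^ (b - 1) * (1 - t * x) := by
        rw [← rpow_add_one (by linarith), sub_add_cancel]
      rw [h2]
      ring
    · exact (hint.mul_continuousOn (hcont t htr' b)).mul_const _
    · refine (hint.mul_continuousOn ?_).const_mul _
      exact ((continuousOn_id.neg.mul continuousOn_const).mul (hcont t htr' (b - 1)))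
  rw [heuler, show a + (σ - 1) + 2 = -b + 1 by linarith, sub_add_cancel,
    Real.Gamma_add_one (by linarith : -b ≠ 0)] at hsplit
  have htb : t ^ (-b) = t ^ (-b - 1) * t := by
    rw [← rpow_add_one ht.1.ne', sub_add_cancel]
  have hG : Real.Gamma (-b) ≠ 0 := (Real.Gamma_pos_of_pos (by linarith)).ne'
  calc _ = t ^ (-b - 1) * ((∫ x in (0 : ℝ)..1, x ^ a * (1 - x) ^ (σ - 1) * (1 - t * x) ^ b) * -b +
      t * (∫ x in (0 : ℝ)..1,
        x ^ a * (1 - x) ^ (σ - 1) * (-x * b * (1 - t * x) ^ (b - 1)))) := by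
        rw [htb]
        ring
    _ = _ := by
        have hb0 : b ≠ 0 := hb.ne
        rw [hsplit]
        field_simp

/-- The coefficient of `(-y) ^ m` in `P_n^{a,b}(1 - 2 * y)`. -/
def jacobiCoeff (n : ℕ) (a b : ℝ) (m : ℕ) : ℝ :=
  (Real.Gamma (a + n + 1) * Real.Gamma (a + b + n + m + 1)) /
    ((m.factorial : ℝ) * ((n - m).factorial : ℝ) * Real.Gamma (a + b + n + 1) *
      Real.Gamma (a + m + 1))

theorem jacobiP_one_sub (n : ℕ) (a b y : ℝ) :
    jacobiP n a b (2 * (1 - y) - 1) =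
      ∑ m ∈ Finset.range (n + 1), (-1) ^ m * jacobiCoeff n a b m * y ^ m := by
  refine Finset.sum_congr rfl fun m _ => ?_
  rw [show (2 * (1 - y) - 1 - 1) / 2 = -1 * y by ring, mul_pow, jacobiCoeff]
  ring

theorem jacobiCoeff_succ {n m : ℕ} {a b : ℝ} (ha : -1 < a) (hab : -1 < a + b) (hm : m < n) :
    (m + 1) * (a + m + 1) * jacobiCoeff n a b (m + 1) =
      (n - m) * (n + m + (a + b + 1)) * jacobiCoeff n a b m := by
  obtain ⟨d, rfl⟩ := Nat.exists_eq_add_of_lt hm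
  have h1 : 0 < a + m + 1 := by linarith [(m.cast_nonneg : (0 : ℝ) ≤ m)]
  have h2 : 0 < a + b + ((m + d + 1 : ℕ) : ℝ) + 1 := by
    linarith [((m + d + 1 : ℕ).cast_nonneg : (0 : ℝ) ≤ ((m + d + 1 : ℕ) : ℝ))]
  have h3 : 0 < a + b + ((m + d + 1 : ℕ) : ℝ) + m + 1 := by
    linarith [(m.cast_nonneg : (0 : ℝ) ≤ m)]
  have g1 := (Real.Gamma_pos_of_pos h1).ne'
  have g2 := (Real.Gamma_pos_of_pos h2).ne'
  have e1 : m + d + 1 - m = d + 1 := by omega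
  have e2 : m + d + 1 - (m + 1) = d := by omega
  have f1 : Real.Gamma (a + ((m + 1 : ℕ) : ℝ) + 1) = (a + m + 1) * Real.Gamma (a + m + 1) := by
    rw [← Real.Gamma_add_one h1.ne']
    push_cast
    ring_nf
  have f2 : Real.Gamma (a + b + ((m + d + 1 : ℕ) : ℝ) + ((m + 1 : ℕ) : ℝ) + 1) =
      (a + b + ((m + d + 1 : ℕ) : ℝ) + m + 1) *
        Real.Gamma (a + b + ((m + d + 1 : ℕ) : ℝ) + m + 1) := by
    rw [← Real.Gamma_add_one h3.ne']
    push_cast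
    ring_nf
  simp only [jacobiCoeff, e1, e2, f1, f2, Nat.factorial_succ]
  push_cast at *
  have hm1 : (m : ℝ) + 1 ≠ 0 := by positivity
  have hd1 : (d : ℝ) + 1 ≠ 0 := by positivity
  field_simp
  ring

theorem jacobiCoeff_self_comm {n : ℕ} {a b : ℝ} (ha : -1 < a) (hb : -1 < b) :
    jacobiCoeff n a b n = jacobiCoeff n b a n := by
  have g1 : Real.Gamma (a + n + 1) ≠ 0 :=
    (Real.Gamma_pos_of_pos (by linarith [(n.cast_nonneg : (0 : ℝ) ≤ n)])).ne'
  have g2 : Real.Gamma (b + n + 1) ≠ 0 :=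
    (Real.Gamma_pos_of_pos (by linarith [(n.cast_nonneg : (0 : ℝ) ≤ n)])).ne'
  rw [jacobiCoeff, jacobiCoeff, add_comm b a]
  field_simp

/-- The coefficient of `y ^ k * z ^ m` in `(1 - z) ^ ν * (1 - y * z) ^ (σ - 1)`. -/
def momentCoeff (σ ν : ℝ) : ℕ → ℕ → ℝ
  | m, 0 => Real.Gamma (m - ν) / (Real.Gamma (-ν) * m.factorial)
  | 0, _ + 1 => 0
  | m + 1, k + 1 => (k + 1 - σ) / (k + 1) * momentCoeff σ ν m k

theorem momentCoeff_succ_succ (σ ν : ℝ) (m k : ℕ) :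
    (k + 1) * momentCoeff σ ν (m + 1) (k + 1) = (k + 1 - σ) * momentCoeff σ ν m k := by
  have : (k : ℝ) + 1 ≠ 0 := by positivity
  rw [momentCoeff]
  field_simp

theorem momentCoeff_eq_zero (σ ν : ℝ) {m k : ℕ} (h : m < k) : momentCoeff σ ν m k = 0 := by
  induction k generalizing m with
  | zero => omega
  | succ k ih =>
    cases m with
    | zero => rw [momentCoeff]
    | succ m => rw [momentCoeff, ih (by omega), mul_zero]

theorem momentCoeff_succ_left {σ ν : ℝ} (hν : ν < 0) (m k : ℕ) :
    (m + 1 - k) * momentCoeff σ ν (m + 1) k = (m - k - ν) * momentCoeff σ ν m k := by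
  induction k generalizing m with
  | zero =>
    have h : (m : ℝ) - ν ≠ 0 := by
      have : (0 : ℝ) ≤ m := m.cast_nonneg
      linarith
    have hG : Real.Gamma (-ν) ≠ 0 := (Real.Gamma_pos_of_pos (by linarith)).ne'
    have e : ((m + 1 : ℕ) : ℝ) - ν = (m - ν) + 1 := by
      push_cast
      ring
    rw [momentCoeff, momentCoeff, e, Real.Gamma_add_one h, Nat.factorial_succ]
    push_cast
    field_simp
    ring
  | succ k ih =>
    cases m with
    | zero =>
      cases k with
      | zero => simp [momentCoeff]
      | succ k =>
        rw [momentCoeff_eq_zero σ ν (by omega : 0 + 1 < k + 1 + 1),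
          momentCoeff_eq_zero σ ν (by omega : 0 < k + 1 + 1)]
        ring
    | succ m =>
      rw [momentCoeff, momentCoeff]
      push_cast
      linear_combination (k + 1 - σ) / (k + 1) * ih m

/-- The moment matrix intertwines the two Jacobi differential operators. -/
theorem momentCoeff_intertwine {σ μ ν : ℝ} (hν : ν < 0) (hσ : μ + ν = -σ) (m k : ℕ) :
    (m + 1 - k) * (m + 1 + k + 1 - σ) * momentCoeff σ ν (m + 1) k +
      (k + 1) * (ν + k + 1) * momentCoeff σ ν (m + 1) (k + 1) =
    (m + 1) * (μ + m + 1) * momentCoeff σ ν m k := by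
  obtain rfl : μ = -σ - ν := by linarith
  linear_combination (m + 1 + k + 1 - σ) * momentCoeff_succ_left (σ := σ) hν m k +
    (ν + k + 1) * momentCoeff_succ_succ σ ν m k

theorem momentCoeff_intertwine_zero (σ ν : ℝ) (k : ℕ) :
    ((0 : ℝ) - k) * (0 + k + 1 - σ) * momentCoeff σ ν 0 k +
      (k + 1) * (ν + k + 1) * momentCoeff σ ν 0 (k + 1) = 0 := by
  cases k with
  | zero => simp [momentCoeff]
  | succ k => simp [momentCoeff]

theorem momentCoeff_self {σ ν : ℝ} (hσ : σ < 1) (hν : ν < 0) (n : ℕ) :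
    momentCoeff σ ν n n = Real.Gamma (n + 1 - σ) / (Real.Gamma (1 - σ) * n.factorial) := by
  have hG : Real.Gamma (1 - σ) ≠ 0 := (Real.Gamma_pos_of_pos (by linarith)).ne'
  induction n with
  | zero =>
    have hG' : Real.Gamma (-ν) ≠ 0 := (Real.Gamma_pos_of_pos (by linarith)).ne'
    simp [momentCoeff, hG, hG']
  | succ n ih =>
    have h : (n : ℝ) + 1 - σ ≠ 0 := by
      have : (0 : ℝ) ≤ n := n.cast_nonneg
      linarith
    have e : ((n + 1 : ℕ) : ℝ) + 1 - σ = n + 1 - σ + 1 := by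
      push_cast
      ring
    rw [momentCoeff, ih, e, Real.Gamma_add_one h, Nat.factorial_succ]
    push_cast
    field_simp

theorem sum_jacobiCoeff_mul_momentCoeff_step {σ μ ν : ℝ} (hσ1 : σ < 1) (hμ : -1 < μ)
    (hν : ν < 0) (hσ : μ + ν = -σ) (n k : ℕ) :
    (n - k) * (n + k + 1 - σ) *
        ∑ m ∈ Finset.range (n + 1), (-1) ^ m * jacobiCoeff n μ ν m * momentCoeff σ ν m k =
      -((k + 1) * (ν + k + 1) *
        ∑ m ∈ Finset.range (n + 1),
          (-1) ^ m * jacobiCoeff n μ ν m * momentCoeff σ ν m (k + 1)) := by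
  have hA : ∑ m ∈ Finset.range (n + 1), ((n : ℝ) - m) * (n + m + 1 - σ) *
      ((-1) ^ m * jacobiCoeff n μ ν m * momentCoeff σ ν m k) =
      -∑ m ∈ Finset.range n, (m + 1) * (μ + m + 1) *
        ((-1) ^ m * jacobiCoeff n μ ν (m + 1) * momentCoeff σ ν m k) * (-1) := by
    rw [Finset.sum_range_succ, sub_self, zero_mul, zero_mul, add_zero, ← Finset.sum_neg_distrib]
    refine Finset.sum_congr rfl fun m hm => ?_
    have := jacobiCoeff_succ (b := ν) hμ (by linarith) (Finset.mem_range.1 hm)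
    rw [hσ] at this
    linear_combination (-(-1) ^ m * momentCoeff σ ν m k) * this
  have hB : ∑ m ∈ Finset.range (n + 1), (-1) ^ m * jacobiCoeff n μ ν m *
      (((m : ℝ) - k) * (m + k + 1 - σ) * momentCoeff σ ν m k +
        (k + 1) * (ν + k + 1) * momentCoeff σ ν m (k + 1)) =
      ∑ m ∈ Finset.range n, (m + 1) * (μ + m + 1) *
        ((-1) ^ m * jacobiCoeff n μ ν (m + 1) * momentCoeff σ ν m k) * (-1) := by
    rw [Finset.sum_range_succ', Nat.cast_zero, momentCoeff_intertwine_zero, mul_zero, add_zero]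
    refine Finset.sum_congr rfl fun m _ => ?_
    push_cast
    rw [momentCoeff_intertwine hν hσ]
    ring
  have hAB := congrArg₂ (· + ·) hA hB
  simp only [← Finset.sum_add_distrib, neg_add_cancel] at hAB
  rw [Finset.mul_sum, Finset.mul_sum, eq_neg_iff_add_eq_zero, ← Finset.sum_add_distrib, ← hAB]
  refine Finset.sum_congr rfl fun m _ => ?_
  ring

theorem sum_jacobiCoeff_mul_momentCoeff {σ μ ν : ℝ} (hσ1 : σ < 1) (hμ : -1 < μ)
    (hν1 : -1 < ν) (hν : ν < 0) (hσ : μ + ν = -σ) {n k : ℕ} (hk : k ≤ n) :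
    ∑ m ∈ Finset.range (n + 1), (-1) ^ m * jacobiCoeff n μ ν m * momentCoeff σ ν m k =
      Real.Gamma (n + 1 - σ) / (Real.Gamma (1 - σ) * n.factorial) *
        ((-1) ^ k * jacobiCoeff n ν μ k) := by
  induction hk using Nat.decreasingInduction with
  | self =>
    rw [Finset.sum_range_succ, Finset.sum_eq_zero, zero_add, momentCoeff_self hσ1 hν,
      jacobiCoeff_self_comm hμ hν1]
    · ring
    · intro m hm
      rw [momentCoeff_eq_zero σ ν (Finset.mem_range.1 hm), mul_zero]
  | of_succ k hk ih =>
    have hkn : (k : ℝ) < n := by exact_mod_cast hk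
    have hk0 : (0 : ℝ) ≤ k := k.cast_nonneg
    have hne : ((n : ℝ) - k) * (n + k + 1 - σ) ≠ 0 :=
      mul_ne_zero (by linarith) (by linarith)
    apply mul_left_cancel₀ hne
    rw [sum_jacobiCoeff_mul_momentCoeff_step hσ1 hμ hν hσ, ih]
    have := jacobiCoeff_succ (b := μ) hν1 (by linarith) hk
    rw [add_comm ν μ, hσ] at this
    linear_combination
      (Real.Gamma (n + 1 - σ) / (Real.Gamma (1 - σ) * n.factorial) * (-1) ^ k) * this

theorem sin_mul_Gamma_mul_Gamma {ν : ℝ} (hν1 : -1 < ν) (hν : ν < 0) :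
    Real.sin (π * ν) * (Real.Gamma (ν + 1) * Real.Gamma (-ν)) = -π := by
  have h := Real.Gamma_mul_Gamma_one_sub (-ν)
  have hsin : Real.sin (π * -ν) ≠ 0 :=
    (Real.sin_pos_of_pos_of_lt_pi (by nlinarith [Real.pi_pos]) (by nlinarith [Real.pi_pos])).ne'
  rw [eq_div_iff hsin, mul_neg, Real.sin_neg, sub_neg_eq_add, add_comm 1 ν] at h
  linarith

/-- The integrand of `rlInt σ` is integrable against a Jacobi weight times a continuous factor. -/
theorem intervalIntegrable_rlInt_integrand {σ a b t : ℝ} (hσ : 0 < σ) (ha : -1 < a)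
    (ht : t ∈ Set.Ioo (0 : ℝ) 1) {q : ℝ → ℝ} (hq : Continuous q) :
    IntervalIntegrable (fun s => (t - s) ^ (σ - 1) * (q s * (s ^ a * (1 - s) ^ b)))
      volume 0 t := by
  have h := ((intervalIntegrable_rpow_mul_one_sub_rpow ha
    (by linarith : -1 < σ - 1)).comp_mul_left (c := t⁻¹))
  rw [zero_div, one_div, inv_inv] at h
  have hcont : ContinuousOn (fun s => (1 - s) ^ b * q s) (Set.uIcc 0 t) := by
    refine ContinuousOn.mul (fun s hs => ?_) hq.continuousOn
    rw [Set.uIcc_of_le ht.1.le] at hs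
    exact (ContinuousAt.rpow_const (by fun_prop)
      (Or.inl (by linarith [hs.2, ht.2]))).continuousWithinAt
  refine ((h.mul_continuousOn hcont).const_mul (t ^ a * t ^ (σ - 1))).congr_uIoo fun s hs => ?_
  rw [uIoo_of_le ht.1.le] at hs
  have e1 : t ^ a * (t⁻¹ * s) ^ a = s ^ a := by
    rw [← mul_rpow ht.1.le (by have := hs.1; have := ht.1; positivity),
      mul_inv_cancel_left₀ ht.1.ne']
  have e2 : t ^ (σ - 1) * (1 - t⁻¹ * s) ^ (σ - 1) = (t - s) ^ (σ - 1) := by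
    have : 0 ≤ 1 - t⁻¹ * s := by
      rw [sub_nonneg, inv_mul_le_one₀ ht.1]
      exact hs.2.le
    rw [← mul_rpow ht.1.le this, mul_sub, mul_inv_cancel_left₀ ht.1.ne', mul_one]
  rw [← e1, ← e2]
  ring

/-- The two-sided fractional integral in the variable `y = 1 - t`. -/
def twoSidedInt (σ A B : ℝ) (φ : ℝ → ℝ) (y : ℝ) : ℝ :=
  A * rlInt σ (fun s => φ (1 - s)) (1 - y) + B * rlInt σ φ y

theorem rlInt_add_mul {σ t : ℝ} (c e : ℝ) {φ : ℝ → ℝ} (ht : 0 ≤ t)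
    (h : IntervalIntegrable (fun s => (t - s) ^ (σ - 1) * φ s) volume 0 t) :
    rlInt σ (fun s => (c + e * (t - s)) * φ s) t =
      c * rlInt σ φ t + e * ∫ s in (0 : ℝ)..t, (t - s) ^ σ * φ s := by
  have hpow : Set.EqOn (fun s => (t - s) * ((t - s) ^ (σ - 1) * φ s))
      (fun s => (t - s) ^ σ * φ s) (Set.Ioo 0 t) := by
    intro s hs
    have h1 : (t - s) ^ σ = (t - s) ^ (σ - 1) * (t - s) := by
      rw [← rpow_add_one (by linarith [hs.2]), sub_add_cancel]
    simp only [h1]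
    ring
  have h' : IntervalIntegrable (fun s => (t - s) * ((t - s) ^ (σ - 1) * φ s)) volume 0 t :=
    h.continuousOn_mul (by fun_prop)
  rw [← intervalIntegral.integral_congr_Ioo_of_le ht hpow, rlInt, rlInt,
    ← intervalIntegral.integral_const_mul, ← intervalIntegral.integral_const_mul,
    ← intervalIntegral.integral_add (h.const_mul c) (h'.const_mul e)]
  refine intervalIntegral.integral_congr fun s _ => ?_
  ring

theorem integral_rpow_mul_reflect (σ : ℝ) (φ : ℝ → ℝ) :
    ∫ s in (0 : ℝ)..1, (1 - s) ^ σ * φ (1 - s) = ∫ u in (0 : ℝ)..1, u ^ σ * φ u := by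
  rw [intervalIntegral.integral_comp_sub_left (fun u => u ^ σ * φ u), sub_self, sub_zero]

theorem twoSidedInt_id_mul {σ A B y : ℝ} (hσ : 0 < σ) {φ : ℝ → ℝ}
    (hφ : IntervalIntegrable φ volume 0 1) (hy : y ∈ Set.Ioo (0 : ℝ) 1)
    (hl : IntervalIntegrable (fun s => (y - s) ^ (σ - 1) * φ s) volume 0 y)
    (hr : IntervalIntegrable (fun s => (1 - y - s) ^ (σ - 1) * φ (1 - s)) volume 0 (1 - y)) :
    twoSidedInt σ A B (fun u => u * φ u) y =
      y * twoSidedInt σ A B φ y + A * (∫ u in (0 : ℝ)..1, u ^ σ * φ u) -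
        σ * ∫ τ in (0 : ℝ)..y, twoSidedInt σ A B φ τ := by
  have hφ' : IntervalIntegrable (fun s => φ (1 - s)) volume 0 1 := by
    simpa using (hφ.comp_sub_left 1).symm
  obtain ⟨il, el⟩ := intervalIntegrable_rlInt_and_integral hσ hφ hy.1.le hy.2.le
  obtain ⟨ir, er⟩ := intervalIntegrable_rlInt_and_integral (t := 1 - y) hσ hφ'
    (by linarith [hy.2]) (by linarith [hy.1])
  obtain ⟨i1, e1⟩ := intervalIntegrable_rlInt_and_integral hσ hφ' zero_le_one le_rfl
  have i2 : IntervalIntegrable (rlInt σ (fun s => φ (1 - s))) volume (1 - y) 1 :=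
    ir.symm.trans i1
  have i3 : IntervalIntegrable (fun τ => rlInt σ (fun s => φ (1 - s)) (1 - τ)) volume 0 y := by
    simpa using (i2.comp_sub_left 1).symm
  have hsplit := intervalIntegral.integral_add_adjacent_intervals ir i2
  have hrefl := intervalIntegral.integral_comp_sub_left (a := 0) (b := y)
    (rlInt σ (fun s => φ (1 - s))) 1
  rw [sub_zero] at hrefl
  rw [integral_rpow_mul_reflect] at e1
  have hL : rlInt σ (fun u => u * φ u) y =
      y * rlInt σ φ y - ∫ s in (0 : ℝ)..y, (y - s) ^ σ * φ s := by
    have := rlInt_add_mul y (-1) hy.1.le hl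
    rw [show (fun s => (y + -1 * (y - s)) * φ s) = fun u => u * φ u by ext; ring] at this
    linarith
  have hR : rlInt σ (fun s => (1 - s) * φ (1 - s)) (1 - y) =
      y * rlInt σ (fun s => φ (1 - s)) (1 - y) +
        ∫ s in (0 : ℝ)..(1 - y), (1 - y - s) ^ σ * φ (1 - s) := by
    have := rlInt_add_mul y 1 (by linarith [hy.2] : 0 ≤ 1 - y) hr
    rw [show (fun s => (y + 1 * (1 - y - s)) * φ (1 - s)) = fun s => (1 - s) * φ (1 - s) by
      ext; ring] at this
    linarith
  simp only [twoSidedInt]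
  rw [intervalIntegral.integral_add (i3.const_mul A) (il.const_mul B),
    intervalIntegral.integral_const_mul, intervalIntegral.integral_const_mul, hL, hR, hrefl,
    ← el, ← er, ← e1, ← hsplit]
  ring

theorem sin_mul_integral_rpow_mul_jacobiWeight {σ μ ν : ℝ} (hν1 : -1 < ν) (hν : ν < 0)
    (hσ : μ + ν = -σ) (m : ℕ) :
    Real.sin (π * ν) * (∫ u in (0 : ℝ)..1, u ^ σ * (u ^ m * (u ^ μ * (1 - u) ^ ν))) =
      -π * momentCoeff σ ν (m + 1) 0 := by
  have hm : (0 : ℝ) ≤ m := m.cast_nonneg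
  have hcongr : Set.EqOn (fun u : ℝ => u ^ σ * (u ^ m * (u ^ μ * (1 - u) ^ ν)))
      (fun u => u ^ (m - ν) * (1 - u) ^ ν) (Set.Ioo 0 1) := by
    intro u hu
    have : u ^ ((m : ℝ) - ν) = u ^ σ * u ^ m * u ^ μ := by
      rw [← rpow_natCast u m, ← rpow_add hu.1, ← rpow_add hu.1]
      congr 1
      linarith
    simp only [this]
    ring
  have hG : Real.Gamma (-ν) ≠ 0 := (Real.Gamma_pos_of_pos (by linarith)).ne'
  rw [intervalIntegral.integral_congr_Ioo_of_le zero_le_one hcongr,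
    integral_rpow_mul_one_sub_rpow_s1 (by linarith) hν1, momentCoeff,
    ← sin_mul_Gamma_mul_Gamma hν1 hν, show (m : ℝ) - ν + ν + 2 = ((m + 1 : ℕ) : ℝ) + 1 by
      push_cast; ring, Real.Gamma_nat_eq_factorial,
    show (m : ℝ) - ν + 1 = ((m + 1 : ℕ) : ℝ) - ν by push_cast; ring]
  field_simp

theorem sum_momentCoeff_succ (σ ν : ℝ) (m : ℕ) (y : ℝ) :
    ∑ k ∈ Finset.range (m + 1 + 1), momentCoeff σ ν (m + 1) k * y ^ k =
      y * (∑ k ∈ Finset.range (m + 1), momentCoeff σ ν m k * y ^ k) + momentCoeff σ ν (m + 1) 0 -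
        σ * ∫ τ in (0 : ℝ)..y, ∑ k ∈ Finset.range (m + 1), momentCoeff σ ν m k * τ ^ k := by
  rw [intervalIntegral.integral_finsetSum
    (fun k _ => (Continuous.intervalIntegrable (by fun_prop) _ _)), Finset.sum_range_succ',
    Finset.mul_sum, Finset.mul_sum, pow_zero, mul_one, add_sub_right_comm,
    ← Finset.sum_sub_distrib]
  congr 1
  refine Finset.sum_congr rfl fun k _ => ?_
  have hk : (k : ℝ) + 1 ≠ 0 := by positivity
  rw [intervalIntegral.integral_const_mul, integral_pow, momentCoeff, zero_pow (by omega)]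
  field_simp
  ring

theorem twoSidedInt_jacobiWeight {σ μ ν y : ℝ} (hσ0 : 0 < σ) (hμ1 : -1 < μ) (hμ : μ < 0)
    (hν1 : -1 < ν) (hν : ν < 0) (hσ : μ + ν = -σ) (hy : y ∈ Set.Ioo (0 : ℝ) 1) :
    twoSidedInt σ (Real.sin (π * ν)) (Real.sin (π * μ)) (fun u => u ^ μ * (1 - u) ^ ν) y =
      -π := by
  set w : ℝ → ℝ := fun u => u ^ μ * (1 - u) ^ ν with hw
  set F := twoSidedInt σ (Real.sin (π * ν)) (Real.sin (π * μ)) w with hF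
  have hw' : (fun s => w (1 - s)) = fun s => s ^ ν * (1 - s) ^ μ := by
    ext s
    simp [hw, mul_comm]
  have hderiv : ∀ t ∈ Set.Ioo (0 : ℝ) 1, HasDerivAt F 0 t := by
    intro t ht
    have ht' : 1 - t ∈ Set.Ioo (0 : ℝ) 1 := ⟨by linarith [ht.2], by linarith [ht.1]⟩
    have h1 := (hasDerivAt_rlInt_jacobiWeight hσ0 hμ1 hν hσ ht).const_mul (Real.sin (π * μ))
    have h2 := ((hasDerivAt_rlInt_jacobiWeight hσ0 hν1 hμ (by linarith) ht').comp_const_sub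
      1 t).const_mul (Real.sin (π * ν))
    rw [← hw'] at h2
    refine (h2.add h1).congr_deriv ?_
    have gμ : Real.Gamma (-μ) ≠ 0 := (Real.Gamma_pos_of_pos (by linarith)).ne'
    have gν : Real.Gamma (-ν) ≠ 0 := (Real.Gamma_pos_of_pos (by linarith)).ne'
    have eμ := sin_mul_Gamma_mul_Gamma hμ1 hμ
    have eν := sin_mul_Gamma_mul_Gamma hν1 hν
    rw [sub_sub_cancel]
    field_simp
    linear_combination Real.Gamma σ * (1 - t) ^ (-μ - 1) * t ^ (-ν - 1) * (eμ - eν)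
  have hconst : ∀ t ∈ Set.Ioo (0 : ℝ) 1, F t = F y := fun t ht =>
    isOpen_Ioo.is_const_of_deriv_eq_zero isPreconnected_Ioo
      (fun s hs => (hderiv s hs).differentiableAt.differentiableWithinAt)
      (fun s hs => (hderiv s hs).deriv) ht hy
  have hwi : IntervalIntegrable w volume 0 1 := intervalIntegrable_rpow_mul_one_sub_rpow hμ1 hν1
  have hwi' : IntervalIntegrable (fun s => w (1 - s)) volume 0 1 := by
    simpa using (hwi.comp_sub_left 1).symm
  obtain ⟨i1, e1⟩ := intervalIntegrable_rlInt_and_integral hσ0 hwi zero_le_one le_rfl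
  obtain ⟨i2, e2⟩ := intervalIntegrable_rlInt_and_integral hσ0 hwi' zero_le_one le_rfl
  have i3 : IntervalIntegrable (fun τ => rlInt σ (fun s => w (1 - s)) (1 - τ)) volume 0 1 := by
    simpa using (i2.comp_sub_left 1).symm
  have hrefl := intervalIntegral.integral_comp_sub_left (a := 0) (b := 1)
    (rlInt σ (fun s => w (1 - s))) 1
  rw [sub_zero, sub_self] at hrefl
  rw [integral_rpow_mul_reflect] at e2
  have hmean : ∫ t in (0 : ℝ)..1, F t = F y := by
    rw [intervalIntegral.integral_congr_Ioo_of_le zero_le_one (g := fun _ => F y) hconst]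
    simp
  have hsum : ∫ t in (0 : ℝ)..1, F t =
      Real.sin (π * ν) * (∫ t in (0 : ℝ)..1, rlInt σ (fun s => w (1 - s)) t) +
        Real.sin (π * μ) * ∫ t in (0 : ℝ)..1, rlInt σ w t := by
    simp only [hF, twoSidedInt]
    rw [intervalIntegral.integral_add (i3.const_mul _) (i1.const_mul _),
      intervalIntegral.integral_const_mul, intervalIntegral.integral_const_mul, hrefl]
  have hone : ∀ {a : ℝ}, a < 0 → momentCoeff σ a (0 + 1) 0 = -a := by
    intro a ha
    have g : Real.Gamma (-a) ≠ 0 := (Real.Gamma_pos_of_pos (by linarith)).ne'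
    rw [momentCoeff, show ((0 + 1 : ℕ) : ℝ) - a = -a + 1 by push_cast; ring,
      Real.Gamma_add_one (by linarith)]
    simp only [zero_add, Nat.factorial_one, Nat.cast_one, mul_one]
    field_simp
  have kν := sin_mul_integral_rpow_mul_jacobiWeight hν1 hν hσ 0
  have kμ := sin_mul_integral_rpow_mul_jacobiWeight hμ1 hμ (by linarith : ν + μ = -σ) 0
  rw [hone hν] at kν
  rw [hone hμ] at kμ
  simp only [pow_zero, one_mul] at kν kμ
  have e3 := integral_rpow_mul_reflect σ (fun s => w (1 - s))
  simp only [sub_sub_cancel] at e3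
  rw [e3] at e1
  rw [show (fun u => u ^ σ * w (1 - u)) = fun u => u ^ σ * (u ^ ν * (1 - u) ^ μ) from
    funext fun u => congrArg (u ^ σ * ·) (congrFun hw' u)] at e1
  apply mul_left_cancel₀ hσ0.ne'
  rw [← hmean, hsum]
  linear_combination Real.sin (π * ν) * e2 + Real.sin (π * μ) * e1 + kν + kμ + π * hσ

theorem twoSidedInt_pow_mul_jacobiWeight {σ μ ν : ℝ} (hσ0 : 0 < σ) (hμ1 : -1 < μ) (hμ : μ < 0)
    (hν1 : -1 < ν) (hν : ν < 0) (hσ : μ + ν = -σ) (m : ℕ) {y : ℝ}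
    (hy : y ∈ Set.Ioo (0 : ℝ) 1) :
    twoSidedInt σ (Real.sin (π * ν)) (Real.sin (π * μ))
        (fun u => u ^ m * (u ^ μ * (1 - u) ^ ν)) y =
      -π * ∑ k ∈ Finset.range (m + 1), momentCoeff σ ν m k * y ^ k := by
  induction m generalizing y with
  | zero =>
    have hG : Real.Gamma (-ν) ≠ 0 := (Real.Gamma_pos_of_pos (by linarith)).ne'
    simpa [momentCoeff, hG] using twoSidedInt_jacobiWeight hσ0 hμ1 hμ hν1 hν hσ hy
  | succ m ih =>
    have hy' : 1 - y ∈ Set.Ioo (0 : ℝ) 1 := ⟨by linarith [hy.2], by linarith [hy.1]⟩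
    have hr := intervalIntegrable_rlInt_integrand (b := μ) (q := fun s => (1 - s) ^ m) hσ0 hν1 hy'
      (by fun_prop)
    have := twoSidedInt_id_mul (A := Real.sin (π * ν)) (B := Real.sin (π * μ)) hσ0
      (φ := fun u => u ^ m * (u ^ μ * (1 - u) ^ ν))
      ((intervalIntegrable_rpow_mul_one_sub_rpow hμ1 hν1).continuousOn_mul (by fun_prop)) hy
      (intervalIntegrable_rlInt_integrand hσ0 hμ1 hy (by fun_prop))
      (by simpa only [sub_sub_cancel, mul_comm ((1 - _ : ℝ) ^ μ)] using hr)
    rw [show (fun u : ℝ => u ^ (m + 1) * (u ^ μ * (1 - u) ^ ν)) =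
      fun u => u * (u ^ m * (u ^ μ * (1 - u) ^ ν)) by ext; ring, this, ih hy,
      sin_mul_integral_rpow_mul_jacobiWeight hν1 hν hσ,
      intervalIntegral.integral_congr_Ioo_of_le hy.1.le
        (fun τ hτ => ih ⟨hτ.1, hτ.2.trans hy.2⟩),
      intervalIntegral.integral_const_mul, sum_momentCoeff_succ]
    ring

theorem twoSidedInt_finset_sum {ι : Type*} (S : Finset ι) {σ A B y : ℝ} (c : ι → ℝ)
    {φ : ι → ℝ → ℝ}
    (hl : ∀ i ∈ S, IntervalIntegrable (fun s => (y - s) ^ (σ - 1) * φ i s) volume 0 y)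
    (hr : ∀ i ∈ S,
      IntervalIntegrable (fun s => (1 - y - s) ^ (σ - 1) * φ i (1 - s)) volume 0 (1 - y)) :
    twoSidedInt σ A B (fun u => ∑ i ∈ S, c i * φ i u) y =
      ∑ i ∈ S, c i * twoSidedInt σ A B (φ i) y := by
  have hsum : ∀ {t : ℝ} {ψ : ι → ℝ → ℝ},
      (∀ i ∈ S, IntervalIntegrable (fun s => (t - s) ^ (σ - 1) * ψ i s) volume 0 t) →
      rlInt σ (fun s => ∑ i ∈ S, c i * ψ i s) t = ∑ i ∈ S, c i * rlInt σ (ψ i) t := by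
    intro t ψ h
    simp only [rlInt, ← intervalIntegral.integral_const_mul]
    rw [← intervalIntegral.integral_finsetSum fun i hi => (h i hi).const_mul (c i)]
    refine intervalIntegral.integral_congr fun s _ => ?_
    simp only [Finset.mul_sum]
    exact Finset.sum_congr rfl fun i _ => by ring
  simp only [twoSidedInt]
  rw [hsum hl, hsum hr, Finset.mul_sum, Finset.mul_sum, ← Finset.sum_add_distrib]
  exact Finset.sum_congr rfl fun i _ => by ring

theorem twoSidedInt_jacobi {σ μ ν : ℝ} (hσ0 : 0 < σ) (hσ1 : σ < 1) (hμ1 : -1 < μ) (hμ : μ < 0)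
    (hν1 : -1 < ν) (hν : ν < 0) (hσ : μ + ν = -σ) (n : ℕ) {y : ℝ}
    (hy : y ∈ Set.Ioo (0 : ℝ) 1) :
    twoSidedInt σ (Real.sin (π * ν)) (Real.sin (π * μ))
        (fun u => (1 - u) ^ ν * u ^ μ * jacobiP n μ ν (2 * (1 - u) - 1)) y =
      -π * (Real.Gamma (n + 1 - σ) / (Real.Gamma (1 - σ) * n.factorial) *
        jacobiP n ν μ (2 * (1 - y) - 1)) := by
  have hy' : 1 - y ∈ Set.Ioo (0 : ℝ) 1 := ⟨by linarith [hy.2], by linarith [hy.1]⟩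
  have hexp : (fun u => (1 - u) ^ ν * u ^ μ * jacobiP n μ ν (2 * (1 - u) - 1)) =
      fun u => ∑ m ∈ Finset.range (n + 1),
        (-1) ^ m * jacobiCoeff n μ ν m * (u ^ m * (u ^ μ * (1 - u) ^ ν)) := by
    ext u
    rw [jacobiP_one_sub, Finset.mul_sum]
    exact Finset.sum_congr rfl fun m _ => by ring
  have hmoment : ∀ m ∈ Finset.range (n + 1),
      (-1) ^ m * jacobiCoeff n μ ν m *
        twoSidedInt σ (Real.sin (π * ν)) (Real.sin (π * μ))
          (fun u => u ^ m * (u ^ μ * (1 - u) ^ ν)) y =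
      ∑ k ∈ Finset.range (n + 1),
        -π * ((-1) ^ m * jacobiCoeff n μ ν m * momentCoeff σ ν m k * y ^ k) := by
    intro m hm
    rw [twoSidedInt_pow_mul_jacobiWeight hσ0 hμ1 hμ hν1 hν hσ m hy,
      Finset.sum_subset (Finset.range_subset_range.2 (Finset.mem_range.1 hm)) fun k _ hk => by
        rw [momentCoeff_eq_zero σ ν (by simpa using hk), zero_mul],
      Finset.mul_sum, Finset.mul_sum]
    exact Finset.sum_congr rfl fun k _ => by ring
  rw [hexp, twoSidedInt_finset_sum, Finset.sum_congr rfl hmoment, Finset.sum_comm,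
    jacobiP_one_sub, Finset.mul_sum, Finset.mul_sum]
  · refine Finset.sum_congr rfl fun k hk => ?_
    rw [← Finset.mul_sum, ← Finset.sum_mul,
      sum_jacobiCoeff_mul_momentCoeff hσ1 hμ1 hν1 hν hσ (Finset.mem_range_succ_iff.1 hk)]
    ring
  · exact fun m _ => intervalIntegrable_rlInt_integrand hσ0 hμ1 hy (by fun_prop)
  · intro m _
    have hr := intervalIntegrable_rlInt_integrand (b := μ) (q := fun s => (1 - s) ^ m) hσ0 hν1 hy'
      (by fun_prop)
    simpa only [sub_sub_cancel, mul_comm ((1 - _ : ℝ) ^ μ)] using hr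

theorem I0r_eq_rlInt (σ : ℝ) (g : ℝ → ℝ) (t : ℝ) :
    I0r σ g t = 1 / Real.Gamma σ * rlInt σ (fun s => g (1 - s)) (1 - t) := by
  have h := intervalIntegral.integral_comp_sub_left (a := 0) (b := 1 - t)
    (fun s => (s - t) ^ (σ - 1) * g s) 1
  rw [sub_zero, sub_sub_cancel] at h
  simp only [sub_right_comm _ _ t] at h
  rw [I0r, ← h, rlInt]

theorem statement1 (p α μ ν : ℝ)
    (hp0 : 0 < p) (hp1 : p < 1) (hα1 : 1 < α) (hα2 : α < 2)
    (hμ1 : α - 2 < μ) (hμ2 : μ < 0) (hν1 : α - 2 < ν) (hν2 : ν < 0)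
    (hsum : μ + ν = α - 2)
    (hbal : p * Real.sin (π * μ) = (1 - p) * Real.sin (π * ν))
    (n : ℕ) (t : ℝ) (ht : t ∈ Set.Ioo (0 : ℝ) 1) :
    Cap α μ ν *
        (p * I0l (2 - α) (fun s => s ^ ν * (1 - s) ^ μ * jacobiP n μ ν (2 * s - 1)) t +
          (1 - p) * I0r (2 - α)
            (fun s => s ^ ν * (1 - s) ^ μ * jacobiP n μ ν (2 * s - 1)) t) =
      (Real.Gamma (n + α - 1) / Real.Gamma (n + 1)) * jacobiP n ν μ (2 * t - 1) := by
  have hsin : Real.sin (π * α) ≠ 0 := by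
    have h : 0 < Real.sin (π * α - π) :=
      Real.sin_pos_of_pos_of_lt_pi (by nlinarith [Real.pi_pos]) (by nlinarith [Real.pi_pos])
    rw [Real.sin_sub_pi] at h
    linarith
  have hrefl : Real.Gamma (2 - α) * Real.Gamma (α - 1) * Real.sin (π * α) = -π := by
    have h := Real.Gamma_mul_Gamma_one_sub (2 - α)
    rw [show π * (2 - α) = 2 * π - π * α by ring, Real.sin_two_pi_sub,
      show 1 - (2 - α) = α - 1 by ring, eq_div_iff (neg_ne_zero.2 hsin)] at h
    linarith
  have hGσ : Real.Gamma (2 - α) ≠ 0 := (Real.Gamma_pos_of_pos (by linarith)).ne'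
  have hGα : Real.Gamma (α - 1) ≠ 0 := (Real.Gamma_pos_of_pos (by linarith)).ne'
  have key := twoSidedInt_jacobi (σ := 2 - α) (μ := μ) (ν := ν) (by linarith) (by linarith)
    (by linarith) hμ2 (by linarith) hν2 (by linarith) n
    (y := 1 - t) ⟨by linarith [ht.2], by linarith [ht.1]⟩
  simp only [twoSidedInt, sub_sub_cancel] at key
  rw [show (n : ℝ) + 1 - (2 - α) = n + α - 1 by ring, show 1 - (2 - α) = α - 1 by ring] at key
  have hleft : I0l (2 - α) (fun s => s ^ ν * (1 - s) ^ μ * jacobiP n μ ν (2 * s - 1)) t =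
      1 / Real.Gamma (2 - α) *
        rlInt (2 - α) (fun s => s ^ ν * (1 - s) ^ μ * jacobiP n μ ν (2 * s - 1)) t := rfl
  rw [I0r_eq_rlInt, hleft, Real.Gamma_nat_eq_factorial, Cap]
  simp only [sub_sub_cancel]
  set L := rlInt (2 - α) (fun s => s ^ ν * (1 - s) ^ μ * jacobiP n μ ν (2 * s - 1)) t
  set R := rlInt (2 - α)
    (fun s => (1 - s) ^ ν * s ^ μ * jacobiP n μ ν (2 * (1 - s) - 1)) (1 - t)
  have hp : (Real.sin (π * μ) + Real.sin (π * ν)) * (p * L + (1 - p) * R) =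
      Real.sin (π * ν) * L + Real.sin (π * μ) * R := by
    linear_combination (L - R) * hbal
  generalize Real.sin (π * α) = S at hsin hrefl ⊢
  calc _ = ((Real.sin (π * μ) + Real.sin (π * ν)) * (p * L + (1 - p) * R)) /
        (Real.Gamma (2 - α) * S) := by
        field_simp
    _ = _ := by
        rw [hp, key, ← hrefl]
        field_simp
end
end
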